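/- arXiv:1112.1012 — 3 statements merged into one kernel-verified Lean document; each statement's English description precedes it below -/
import Mathlib

section
/- Let A_1, A_2 be full-dimensional finite configurations in ℤ² and A = Cay(A_1,A_2) their Cayley configuration. The bidegree of the principal A-determinant cycle Ẽ_A equals (3·area(Q_1) + area(Q_2) + 2·MV(Q_1,Q_2), area(Q_1) + 3·area(Q_2) + 2·MV(Q_1,Q_2)). -/
open scoped Pointwise
open MeasureTheory

noncomputable section

abbrev Pt : Type := ℤ × ℤ
abbrev Pt3 : Type := ℤ × ℤ × ℤ

def toR2 (p : Pt) : ℝ × ℝ := ((p.1 : ℝ), (p.2 : ℝ))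
def toR3 (p : Pt3) : ℝ × ℝ × ℝ := ((p.1 : ℝ), (p.2.1 : ℝ), (p.2.2 : ℝ))

/-- Normalized lattice area (a primitive lattice triangle has area 1). -/
def narea (A : Finset Pt) : ℝ :=
  2 * (volume (convexHull ℝ (toR2 '' (A : Set Pt)))).toReal

/-- Normalized 3-dimensional lattice volume (a primitive lattice tetrahedron has
volume 1). -/
def nvol3 (S : Finset Pt3) : ℝ :=
  6 * (volume (convexHull ℝ (toR3 '' (S : Set Pt3)))).toReal

/-- A planar configuration is full-dimensional if its points are not collinear. -/
def FullDim (A : Finset Pt) : Prop := ¬ Collinear ℝ (toR2 '' (A : Set Pt))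

/-- Mixed volume (mixed area) of the convex hulls of two configurations. -/
def mvol (A B : Finset Pt) : ℝ := (narea (A + B) - narea A - narea B) / 2

/-- the Cayley configuration of `A₁` and `A₂`, realized in `ℤ³ ≅ ℤ⁴ ∩ {x₁+x₂=1}`
via `(x₁, x₂, a) ↦ (x₁, a)`. -/
def cayley3 (A₁ A₂ : Finset Pt) : Finset Pt3 :=
  A₁.image (fun a => ((1 : ℤ), a)) ∪ A₂.image (fun b => ((0 : ℤ), b))

end

noncomputable section

/-- `T` is a triangulation of the 3-dimensional configuration `A ⊂ ℤ³`: a collection of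
full-dimensional lattice simplices with vertices in `A`, covering `conv(A)`, any two of
which intersect in the convex hull of their common point set (a common face). -/
def IsTriangulation3 (A : Finset Pt3) (T : Finset (Finset Pt3)) : Prop :=
  (∀ σ ∈ T, σ ⊆ A ∧ σ.card = 4 ∧
      AffineIndependent ℝ (fun p : {x // x ∈ σ} => toR3 p.1)) ∧
  (⋃ σ ∈ T, convexHull ℝ (toR3 '' (σ : Set Pt3))) = convexHull ℝ (toR3 '' (A : Set Pt3)) ∧
  (∀ σ ∈ T, ∀ τ ∈ T,
      convexHull ℝ (toR3 '' (σ : Set Pt3)) ∩ convexHull ℝ (toR3 '' (τ : Set Pt3))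
        = convexHull ℝ (toR3 '' ((σ ∩ τ : Finset Pt3) : Set Pt3)))

/-- the GKZ vector of a triangulation `T` of `A`:
`φ_T(α) = Σ_{σ ∈ T, α ∈ σ} vol(σ)`. -/
def gkzVector (A : Finset Pt3) (T : Finset (Finset Pt3)) : {x // x ∈ A} → ℝ :=
  fun α => ∑ σ ∈ T.filter (fun σ => α.1 ∈ σ), nvol3 σ

/-- the secondary polytope of `A`: the convex hull of the GKZ vectors of the
triangulations of `A`. -/
def secondaryPolytope (A : Finset Pt3) : Set ({x // x ∈ A} → ℝ) :=
  convexHull ℝ {φ | ∃ T, IsTriangulation3 A T ∧ φ = gkzVector A T}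

/-- the Newton polytope of an integer polynomial: the convex hull of its exponent
vectors. -/
def newtonPolytope (A : Finset Pt3) (p : MvPolynomial {x // x ∈ A} ℤ) :
    Set ({x // x ∈ A} → ℝ) :=
  convexHull ℝ ((fun m : {x // x ∈ A} →₀ ℕ => fun α => ((m α : ℕ) : ℝ)) '' ↑p.support)

/-- degree of `p` in the block of variables lying over the configuration `A₁`
(the points of the Cayley configuration with first coordinate `1`). -/
def cblockDeg (A : Finset Pt3) (i : ℤ) (p : MvPolynomial {x // x ∈ A} ℤ) : ℕ :=
  p.support.sup fun m => m.sum fun α k => if α.1.1 = i then k else 0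

section Triangulation

lemma sum_exchange {ι F : Type*} [AddCommGroup F] [Module ℝ F] [DecidableEq ι] {σ : Finset ι}
    {a s₀ : ι} {c : ι → ℝ} {ε : ℝ} (ha : a ∉ σ) (hs₀ : s₀ ∈ σ) (hc : c s₀ = 0) (g : ι → F) :
    ∑ s ∈ insert a (σ.erase s₀), (if s = a then ε else c s) • g s =
      ε • g a + ∑ s ∈ σ, c s • g s := by
  rw [Finset.sum_insert fun h => ha (Finset.mem_of_mem_erase h), if_pos rfl,
    ← Finset.add_sum_erase σ _ hs₀, hc, zero_smul, zero_add]
  congr 1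
  refine Finset.sum_congr rfl fun s hs => ?_
  rw [if_neg fun h : s = a => ha (h ▸ Finset.mem_of_mem_erase hs)]

variable {E : Type*} [NormedAddCommGroup E] [NormedSpace ℝ E]

/-- A finite set of points that is an affine basis of the ambient space. -/
def IsSpanningSimplex (σ : Finset E) : Prop :=
  AffineIndependent ℝ (Subtype.val : {x // x ∈ σ} → E) ∧ affineSpan ℝ (σ : Set E) = ⊤

/-- `β` restricts to a system of barycentric coordinates on `σ`. -/
def IsBarycentric (σ : Finset E) (β : E → E →ᵃ[ℝ] ℝ) : Prop :=
  (∀ x, ∑ s ∈ σ, β s x = 1) ∧ (∀ x, ∑ s ∈ σ, β s x • s = x) ∧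
    ∀ s ∈ σ, ∀ t ∈ σ, s ≠ t → β s t = 0

lemma IsSpanningSimplex.exists_isBarycentric {σ : Finset E} (h : IsSpanningSimplex σ) :
    ∃ β, IsBarycentric σ β := by
  classical
  let b : AffineBasis {x // x ∈ σ} ℝ E := ⟨Subtype.val, h.1, by
    rw [Subtype.range_coe_subtype]; exact h.2⟩
  refine ⟨fun s => if hs : s ∈ σ then b.coord ⟨s, hs⟩ else 0, fun x => ?_, fun x => ?_, ?_⟩
  · rw [← Finset.sum_coe_sort]
    simpa using b.sum_coord_apply_eq_one x
  · rw [← Finset.sum_coe_sort]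
    simpa using! b.linear_combination_coord_eq_self x
  · intro s hs t ht hst
    have := b.coord_apply ⟨s, hs⟩ ⟨t, ht⟩
    simp only [hs, dif_pos]
    rw [if_neg (by simpa using hst)] at this
    exact this

lemma IsBarycentric.apply_self {σ : Finset E} {β : E → E →ᵃ[ℝ] ℝ} (h : IsBarycentric σ β)
    {s : E} (hs : s ∈ σ) : β s s = 1 := by
  rw [← h.1 s, Finset.sum_eq_single_of_mem s hs]
  intro t ht hts
  exact h.2.2 t ht s hs hts

lemma IsBarycentric.nonneg {σ : Finset E} {β : E → E →ᵃ[ℝ] ℝ} (h : IsBarycentric σ β)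
    {x : E} (hx : x ∈ convexHull ℝ (σ : Set E)) {s : E} (hs : s ∈ σ) : 0 ≤ β s x := by
  have hsub : convexHull ℝ (σ : Set E) ⊆ β s ⁻¹' Set.Ici 0 := by
    refine convexHull_min (fun t ht => ?_) ((convex_Ici 0).affine_preimage (β s))
    by_cases hst : s = t
    · subst hst
      simp [h.apply_self hs]
    · simp [h.2.2 s hs t ht hst]
  exact hsub hx

lemma affineMap_sum_smul_of_sum_eq_one {σ : Finset E} {w : E → ℝ} (hw : ∑ s ∈ σ, w s = 1)
    (f : E →ᵃ[ℝ] ℝ) : f (∑ s ∈ σ, w s • s) = ∑ s ∈ σ, w s * f s := by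
  have h := Finset.map_affineCombination σ (fun e : E => e) w hw f
  rw [Finset.affineCombination_eq_linear_combination _ _ _ hw,
    Finset.affineCombination_eq_linear_combination _ _ _ hw] at h
  simpa using h

lemma sum_smul_mem_convexHull {σ : Finset E} {w : E → ℝ} (h0 : ∀ s ∈ σ, 0 ≤ w s)
    (h1 : ∑ s ∈ σ, w s = 1) : ∑ s ∈ σ, w s • s ∈ convexHull ℝ (σ : Set E) :=
  (convex_convexHull ℝ _).sum_mem h0 h1 fun _ hs => subset_convexHull ℝ _ hs

/-- The affine interpolation of the heights `ω` at the vertices of `σ`. -/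
def interpolation (σ : Finset E) (β : E → E →ᵃ[ℝ] ℝ) (ω : E → ℝ) : E →ᵃ[ℝ] ℝ :=
  ∑ s ∈ σ, ω s • β s

lemma interpolation_apply (σ : Finset E) (β : E → E →ᵃ[ℝ] ℝ) (ω : E → ℝ) (x : E) :
    interpolation σ β ω x = ∑ s ∈ σ, ω s * β s x := by
  classical
  unfold interpolation
  induction σ using Finset.induction_on with
  | empty => simp
  | insert a s ha ih => simp [Finset.sum_insert ha, ih]

lemma IsBarycentric.interpolation_vertex {σ : Finset E} {β : E → E →ᵃ[ℝ] ℝ}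
    (h : IsBarycentric σ β) (ω : E → ℝ) {s : E} (hs : s ∈ σ) :
    interpolation σ β ω s = ω s := by
  rw [interpolation_apply, Finset.sum_eq_single_of_mem s hs, h.apply_self hs, mul_one]
  intro t ht hts
  rw [h.2.2 t ht s hs hts, mul_zero]

lemma exists_generic_height (A : Finset E) (β : Finset E → E → E →ᵃ[ℝ] ℝ) :
    ∃ ω : E → ℝ, ∀ σ ⊆ A, ∀ a ∈ A, a ∉ σ → interpolation σ (β σ) ω a ≠ ω a := by
  classical
  let φ : Finset E × E → ((E → ℝ) →ₗ[ℝ] ℝ) := fun q =>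
    ∑ s ∈ q.1, β q.1 s q.2 • LinearMap.proj s - LinearMap.proj q.2
  have hφ (q : Finset E × E) (ω : E → ℝ) : φ q ω = interpolation q.1 (β q.1) ω q.2 - ω q.2 := by
    simp [φ, interpolation_apply, mul_comm]
  let P : Finset (Finset E × E) := (A.powerset ×ˢ A).filter fun q => q.2 ∉ q.1
  have htop : (⊤ : Subspace ℝ (E → ℝ)) ∉ P.image fun q => LinearMap.ker (φ q) := by
    intro hmem
    obtain ⟨q, hq, hker⟩ := Finset.mem_image.1 hmem
    have hq2 : q.2 ∉ q.1 := (Finset.mem_filter.1 hq).2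
    have h0 : φ q (Pi.single q.2 1) = 0 := by
      rw [LinearMap.ker_eq_top.1 hker]; rfl
    rw [hφ, interpolation_apply, Finset.sum_eq_zero] at h0
    · simp at h0
    · intro s hs
      have : s ≠ q.2 := fun h => hq2 (h ▸ hs)
      simp [Pi.single_eq_of_ne this]
  obtain ⟨ω, hω⟩ := (Set.ne_univ_iff_exists_notMem _).1
    (Subspace.biUnion_ne_univ_of_top_notMem htop)
  refine ⟨ω, fun σ hσ a ha haσ heq => hω ?_⟩
  refine Set.mem_iUnion₂.2 ⟨LinearMap.ker (φ (σ, a)), Finset.mem_image.2 ⟨(σ, a), ?_, rfl⟩, ?_⟩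
  · simp [P, ha, haσ, hσ]
  · simp [hφ, heq]

/-- `x` lies on no proper affine subspace spanned by points of `A`. -/
def IsAffinelyGeneric (A : Finset E) (x : E) : Prop :=
  ∀ t ⊆ A, x ∈ affineSpan ℝ (t : Set E) → affineSpan ℝ (t : Set E) = ⊤

lemma dense_compl_affineSubspace {S : AffineSubspace ℝ E} (hS : S ≠ ⊤) :
    Dense ((S : Set E)ᶜ) := by
  rw [← interior_eq_empty_iff_dense_compl]
  by_contra hne
  apply hS
  have := IsOpen.affineSpan_eq_top isOpen_interior (Set.nonempty_iff_ne_empty.2 hne)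
  rw [eq_top_iff, ← this]
  exact affineSpan_le.2 interior_subset

lemma dense_isAffinelyGeneric [FiniteDimensional ℝ E] (A : Finset E) :
    Dense {x | IsAffinelyGeneric A x} := by
  classical
  let P := A.powerset.filter fun t : Finset E => affineSpan ℝ (t : Set E) ≠ ⊤
  have hd : Dense (⋂ t : {t // t ∈ P}, ((affineSpan ℝ (t.1 : Set E) : Set E)ᶜ)) := by
    refine dense_iInter_of_isOpen (fun t => ?_) fun t => ?_
    · exact (AffineSubspace.closed_of_finiteDimensional _).isOpen_compl
    · exact dense_compl_affineSubspace (Finset.mem_filter.1 t.2).2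
  refine hd.mono fun x hx t ht hxt => ?_
  by_contra htop
  exact Set.mem_iInter.1 hx ⟨t, Finset.mem_filter.2 ⟨Finset.mem_powerset.2 ht, htop⟩⟩ hxt

lemma IsSpanningSimplex.card_eq [FiniteDimensional ℝ E] {σ : Finset E} (h : IsSpanningSimplex σ) :
    σ.card = Module.finrank ℝ E + 1 := by
  have := h.1.affineSpan_eq_top_iff_card_eq_finrank_add_one
  rw [Subtype.range_coe_subtype] at this
  simpa using this.1 h.2

lemma isSpanningSimplex_of_card_eq {σ : Finset E} (hspan : affineSpan ℝ (σ : Set E) = ⊤)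
    (hcard : σ.card = Module.finrank ℝ E + 1) : IsSpanningSimplex σ := by
  refine ⟨?_, hspan⟩
  rw [affineIndependent_iff_finrank_vectorSpan_eq ℝ _ (n := Module.finrank ℝ E)
    (by simpa using hcard), Subtype.range_coe_subtype]
  change Module.finrank ℝ (vectorSpan ℝ (σ : Set E)) = _
  rw [← direction_affineSpan, hspan, AffineSubspace.direction_top, finrank_top]

lemma exists_isSpanningSimplex_mem_convexHull {A : Finset E} {x : E} (hgen : IsAffinelyGeneric A x)
    (hx : x ∈ convexHull ℝ (A : Set E)) :
    ∃ σ ⊆ A, IsSpanningSimplex σ ∧ x ∈ convexHull ℝ (σ : Set E) := by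
  rw [convexHull_eq_union] at hx
  simp only [Set.mem_iUnion] at hx
  obtain ⟨t, htA, hind, hxt⟩ := hx
  have htA' : t ⊆ A := by exact_mod_cast htA
  exact ⟨t, htA', ⟨hind, hgen t htA' (convexHull_subset_affineSpan _ hxt)⟩, hxt⟩

lemma IsBarycentric.pos_of_isAffinelyGeneric {A σ : Finset E} {β : E → E →ᵃ[ℝ] ℝ}
    (hβ : IsBarycentric σ β) (hσA : σ ⊆ A) {x : E}
    (hgen : IsAffinelyGeneric A x) (hx : x ∈ convexHull ℝ (σ : Set E)) {s : E} (hs : s ∈ σ) :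
    0 < β s x := by
  classical
  refine lt_of_le_of_ne (hβ.nonneg hx hs) fun h0 => ?_
  have hsum : ∑ t ∈ σ.erase s, β t x = 1 := by
    rw [← hβ.1 x, ← Finset.add_sum_erase _ _ hs, ← h0, zero_add]
  have hmem : x ∈ convexHull ℝ ((σ.erase s : Finset E) : Set E) := by
    have := sum_smul_mem_convexHull (σ := σ.erase s) (w := fun t => β t x)
      (fun t ht => hβ.nonneg hx (Finset.mem_of_mem_erase ht)) hsum
    convert this using 1
    conv_lhs => rw [← hβ.2.1 x, ← Finset.add_sum_erase _ _ hs, ← h0, zero_smul, zero_add]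
  have htop := hgen (σ.erase s) ((Finset.erase_subset _ _).trans hσA)
    (convexHull_subset_affineSpan _ hmem)
  have hsub : affineSpan ℝ ((σ.erase s : Finset E) : Set E) ≤
      (affineSpan ℝ {(0 : ℝ)}).comap (β s) := by
    refine affineSpan_le.2 fun t ht => ?_
    have ht' := Finset.mem_erase.1 (Finset.mem_coe.1 ht)
    simp [hβ.2.2 s hs t ht'.2 ht'.1.symm]
  have hs0 := hsub (htop ▸ AffineSubspace.mem_top ℝ E s)
  simp [hβ.apply_self hs] at hs0

/-- A simplex around a generic point whose interpolation overshoots the height of some point can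
be exchanged for one with a smaller interpolated height. -/
lemma exists_lower_simplex [FiniteDimensional ℝ E] {A σ : Finset E} {β : Finset E → E → E →ᵃ[ℝ] ℝ}
    (hβ : ∀ τ, IsSpanningSimplex τ → IsBarycentric τ (β τ)) {ω : E → ℝ} (hσA : σ ⊆ A)
    (hσ : IsSpanningSimplex σ) {x : E} (hgen : IsAffinelyGeneric A x)
    (hx : x ∈ convexHull ℝ (σ : Set E)) {a : E} (ha : a ∈ A)
    (hlt : ω a < interpolation σ (β σ) ω a) :
    ∃ τ ⊆ A, IsSpanningSimplex τ ∧ x ∈ convexHull ℝ (τ : Set E) ∧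
      interpolation τ (β τ) ω x < interpolation σ (β σ) ω x := by
  classical
  have hb := hβ σ hσ
  have haσ : a ∉ σ := fun h => by rw [hb.interpolation_vertex ω h] at hlt; exact lt_irrefl _ hlt
  have hpos : ∀ s ∈ σ, 0 < β σ s x := fun s hs =>
    hb.pos_of_isAffinelyGeneric hσA hgen hx hs
  have hne : (σ.filter fun s => 0 < β σ s a).Nonempty := by
    by_contra hcon
    rw [Finset.not_nonempty_iff_eq_empty, Finset.filter_eq_empty_iff] at hcon
    have := Finset.sum_nonpos fun s hs => not_lt.1 (hcon hs)
    rw [hb.1 a] at this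
    linarith
  obtain ⟨s₀, hs₀, hmin⟩ := Finset.exists_min_image _ (fun s => β σ s x / β σ s a) hne
  obtain ⟨hs₀σ, hs₀a⟩ := Finset.mem_filter.1 hs₀
  set ε : ℝ := β σ s₀ x / β σ s₀ a with hε
  have hεpos : 0 < ε := div_pos (hpos s₀ hs₀σ) hs₀a
  let c : E → ℝ := fun s => β σ s x - ε * β σ s a
  have hε0 : c s₀ = 0 := by simp only [c, hε]; field_simp; ring
  let w : E → ℝ := fun s => if s = a then ε else c s
  let τ := insert a (σ.erase s₀)
  have haE : a ∉ σ.erase s₀ := fun h => haσ (Finset.mem_of_mem_erase h)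
  have hwc : ∀ s ∈ σ.erase s₀, w s = c s := fun s hs =>
    if_neg fun h : s = a => haE (h ▸ hs)
  have hc : ∀ s ∈ σ, 0 ≤ c s := by
    intro s hs
    by_cases hsa : 0 < β σ s a
    · have := hmin s (Finset.mem_filter.2 ⟨hs, hsa⟩)
      have := (le_div_iff₀ hsa).1 this
      simp only [c]
      linarith
    · have := mul_nonneg hεpos.le (neg_nonneg.2 (not_lt.1 hsa))
      have := hpos s hs
      simp only [c]
      linarith
  have hw0 : ∀ s ∈ τ, 0 ≤ w s := by
    intro s hs
    rcases Finset.mem_insert.1 hs with rfl | hs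
    · simp [w, hεpos.le]
    · rw [hwc s hs]
      exact hc s (Finset.mem_of_mem_erase hs)
  have hw1 : ∑ s ∈ τ, w s = 1 := by
    have : ∑ s ∈ τ, w s • (1 : ℝ) = ε • (1 : ℝ) + ∑ s ∈ σ, c s • (1 : ℝ) :=
      sum_exchange haσ hs₀σ hε0 fun _ => 1
    simp only [smul_eq_mul, mul_one, c, Finset.sum_sub_distrib, ← Finset.mul_sum, hb.1] at this
    linarith
  have hwx : ∑ s ∈ τ, w s • s = x := by
    have : ∑ s ∈ τ, w s • s = ε • a + ∑ s ∈ σ, c s • s :=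
      sum_exchange haσ hs₀σ hε0 fun s => s
    simp only [c, sub_smul, mul_smul, Finset.sum_sub_distrib, ← Finset.smul_sum, hb.2.1] at this
    rw [this]
    abel
  have hτA : τ ⊆ A := Finset.insert_subset ha ((Finset.erase_subset _ _).trans hσA)
  have hxτ : x ∈ convexHull ℝ (τ : Set E) := hwx ▸ sum_smul_mem_convexHull hw0 hw1
  have hτ : IsSpanningSimplex τ := by
    refine isSpanningSimplex_of_card_eq (hgen τ hτA (convexHull_subset_affineSpan _ hxτ)) ?_
    rw [Finset.card_insert_of_notMem haE, Finset.card_erase_add_one hs₀σ, hσ.card_eq]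
  refine ⟨τ, hτA, hτ, hxτ, ?_⟩
  have h1 : interpolation τ (β τ) ω x = ∑ s ∈ τ, w s * ω s := by
    conv_lhs => rw [← hwx]
    rw [affineMap_sum_smul_of_sum_eq_one hw1]
    exact Finset.sum_congr rfl fun s hs => by rw [(hβ τ hτ).interpolation_vertex ω hs]
  have h2 : ∑ s ∈ τ, w s • ω s = ε • ω a + ∑ s ∈ σ, c s • ω s :=
    sum_exchange haσ hs₀σ hε0 ω
  have h3 : ∑ s ∈ σ, c s * ω s =
      interpolation σ (β σ) ω x - ε * interpolation σ (β σ) ω a := by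
    rw [interpolation_apply, interpolation_apply, Finset.mul_sum, ← Finset.sum_sub_distrib]
    exact Finset.sum_congr rfl fun s _ => by simp only [c]; ring
  simp only [smul_eq_mul] at h2
  rw [h1, h2, h3]
  have := mul_lt_mul_of_pos_left hlt hεpos
  linarith

/-- Every finite point configuration that affinely spans the space has a triangulation. -/
theorem exists_triangulation [FiniteDimensional ℝ E] (A : Finset E)
    (hA : affineSpan ℝ (A : Set E) = ⊤) :
    ∃ T : Finset (Finset E), (∀ σ ∈ T, σ ⊆ A ∧ IsSpanningSimplex σ) ∧
      (⋃ σ ∈ T, convexHull ℝ (σ : Set E)) = convexHull ℝ (A : Set E) ∧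
      ∀ σ ∈ T, ∀ τ ∈ T, convexHull ℝ (σ : Set E) ∩ convexHull ℝ (τ : Set E) ⊆
        convexHull ℝ ((σ : Set E) ∩ τ) := by
  classical
  have hex : ∀ σ : Finset E, ∃ β, IsSpanningSimplex σ → IsBarycentric σ β := fun σ => by
    by_cases h : IsSpanningSimplex σ
    · exact h.exists_isBarycentric.imp fun _ hβ _ => hβ
    · exact ⟨0, fun h' => absurd h' h⟩
  choose β hβ using hex
  obtain ⟨ω, hω⟩ := exists_generic_height A β
  let B := A.powerset.filter IsSpanningSimplex
  have hB {σ : Finset E} : σ ∈ B ↔ σ ⊆ A ∧ IsSpanningSimplex σ := by simp [B]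
  let T := B.filter fun σ => ∀ a ∈ A, interpolation σ (β σ) ω a ≤ ω a
  have hT {σ : Finset E} : σ ∈ T ↔ (σ ⊆ A ∧ IsSpanningSimplex σ) ∧
      ∀ a ∈ A, interpolation σ (β σ) ω a ≤ ω a := by rw [Finset.mem_filter, hB]
  refine ⟨T, fun σ hσ => (hT.1 hσ).1, Set.Subset.antisymm ?_ ?_, ?_⟩
  · exact Set.iUnion₂_subset fun σ hσ => convexHull_mono (by exact_mod_cast (hT.1 hσ).1.1)
  · have hclosed : IsClosed (⋃ σ ∈ T, convexHull ℝ (σ : Set E)) :=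
      T.finite_toSet.isClosed_biUnion fun σ _ => σ.finite_toSet.isClosed_convexHull ℝ
    have hgen : ∀ x ∈ convexHull ℝ (A : Set E), IsAffinelyGeneric A x →
        x ∈ ⋃ σ ∈ T, convexHull ℝ (σ : Set E) := by
      intro x hx hxgen
      have hne : (B.filter fun σ : Finset E => x ∈ convexHull ℝ (σ : Set E)).Nonempty := by
        obtain ⟨σ, hσA, hσ, hxσ⟩ := exists_isSpanningSimplex_mem_convexHull hxgen hx
        exact ⟨σ, Finset.mem_filter.2 ⟨hB.2 ⟨hσA, hσ⟩, hxσ⟩⟩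
      obtain ⟨σ, hσ, hmin⟩ :=
        Finset.exists_min_image _ (fun σ => interpolation σ (β σ) ω x) hne
      obtain ⟨hσB, hxσ⟩ := Finset.mem_filter.1 hσ
      obtain ⟨hσA, hσs⟩ := hB.1 hσB
      refine Set.mem_iUnion₂.2 ⟨σ, hT.2 ⟨⟨hσA, hσs⟩, fun a ha => ?_⟩, hxσ⟩
      by_contra hcon
      obtain ⟨τ, hτA, hτ, hxτ, hlt⟩ :=
        exists_lower_simplex hβ hσA hσs hxgen hxσ ha (not_le.1 hcon)
      exact (hmin τ (Finset.mem_filter.2 ⟨hB.2 ⟨hτA, hτ⟩, hxτ⟩)).not_gt hlt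
    have hint : (interior (convexHull ℝ (A : Set E))).Nonempty :=
      interior_convexHull_nonempty_iff_affineSpan_eq_top.2 hA
    calc convexHull ℝ (A : Set E) ⊆ closure (convexHull ℝ (A : Set E)) := subset_closure
      _ = closure (interior (convexHull ℝ (A : Set E))) :=
        ((convex_convexHull ℝ _).closure_interior_eq_closure_of_nonempty_interior hint).symm
      _ ⊆ ⋃ σ ∈ T, convexHull ℝ (σ : Set E) := by
        refine closure_minimal ?_ hclosed
        refine ((dense_isAffinelyGeneric A).open_subset_closure_inter isOpen_interior).trans ?_
        exact closure_minimal (fun x hx => hgen x (interior_subset hx.1) hx.2) hclosed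
  · rintro σ hσ τ hτ x ⟨hxσ, hxτ⟩
    obtain ⟨⟨hσA, hσs⟩, hσω⟩ := hT.1 hσ
    obtain ⟨⟨hτA, hτs⟩, hτω⟩ := hT.1 hτ
    have key : ∀ {σ τ : Finset E}, σ ⊆ A → IsSpanningSimplex σ → x ∈ convexHull ℝ (σ : Set E) →
        (∀ a ∈ A, interpolation τ (β τ) ω a ≤ ω a) →
        0 ≤ ∑ s ∈ σ, β σ s x * (ω s - interpolation τ (β τ) ω s) ∧
        ∑ s ∈ σ, β σ s x * (ω s - interpolation τ (β τ) ω s) =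
          interpolation σ (β σ) ω x - interpolation τ (β τ) ω x := by
      intro σ τ hσA hσs hxσ hτω
      have hb := hβ σ hσs
      refine ⟨Finset.sum_nonneg fun s hs =>
        mul_nonneg (hb.nonneg hxσ hs) (sub_nonneg.2 (hτω s (hσA hs))), ?_⟩
      conv_rhs => rw [interpolation_apply, ← hb.2.1 x,
        affineMap_sum_smul_of_sum_eq_one (hb.1 x), hb.2.1 x, ← Finset.sum_sub_distrib]
      exact Finset.sum_congr rfl fun s _ => by ring
    obtain ⟨h1, h2⟩ := key (τ := τ) hσA hσs hxσ hτω
    obtain ⟨h3, h4⟩ := key (τ := σ) hτA hτs hxτ hσω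
    have h0 : ∑ s ∈ σ, β σ s x * (ω s - interpolation τ (β τ) ω s) = 0 := by linarith
    have hb := hβ σ hσs
    rw [Finset.sum_eq_zero_iff_of_nonneg fun s hs =>
      mul_nonneg (hb.nonneg hxσ hs) (sub_nonneg.2 (hτω s (hσA hs)))] at h0
    have hzero : ∀ s ∈ σ, s ∉ σ ∩ τ → β σ s x = 0 := by
      intro s hs hsn
      have hsτ : s ∉ τ := fun h => hsn (Finset.mem_inter.2 ⟨hs, h⟩)
      exact (mul_eq_zero.1 (h0 s hs)).resolve_right
        (sub_ne_zero.2 (hω τ hτA s (hσA hs) hsτ).symm)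
    rw [← Finset.coe_inter, ← hb.2.1 x,
      ← Finset.sum_subset Finset.inter_subset_left fun s hs hsn => by
        rw [hzero s hs hsn, zero_smul]]
    refine sum_smul_mem_convexHull
      (fun s hs => hb.nonneg hxσ (Finset.mem_of_mem_inter_left hs)) ?_
    rw [← hb.1 x]
    exact Finset.sum_subset Finset.inter_subset_left hzero

end Triangulation

/-- The convex hull in the real plane of a planar lattice configuration. -/
def planeHull (B : Finset Pt) : Set (ℝ × ℝ) := convexHull ℝ (toR2 '' (B : Set Pt))

/-- The weighted Minkowski sum `t Q₁ + (1 - t) Q₂`. -/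
def mixedHull (t : ℝ) (B C : Finset Pt) : Set (ℝ × ℝ) :=
  t • planeHull B + (1 - t) • planeHull C

lemma toR3_image_cayley3 (B C : Finset Pt) :
    toR3 '' (cayley3 B C : Set Pt3) =
      ({1} ×ˢ (toR2 '' (B : Set Pt))) ∪ ({0} ×ˢ (toR2 '' (C : Set Pt))) := by
  ext ⟨x, y⟩
  simp only [cayley3, Finset.coe_union, Finset.coe_image, Set.image_union, Set.image_image,
    Set.mem_union, Set.mem_image, Set.mem_prod, Set.mem_singleton_iff, toR3, toR2, Prod.mk.injEq,
    Int.cast_one, Int.cast_zero]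
  constructor
  · rintro (⟨b, hb, rfl, rfl⟩ | ⟨b, hb, rfl, rfl⟩)
    · exact Or.inl ⟨rfl, b, hb, rfl⟩
    · exact Or.inr ⟨rfl, b, hb, rfl⟩
  · rintro (⟨rfl, b, hb, rfl⟩ | ⟨rfl, b, hb, rfl⟩)
    · exact Or.inl ⟨b, hb, rfl, rfl⟩
    · exact Or.inr ⟨b, hb, rfl, rfl⟩

lemma slice_convexHull_cayley3 {t : ℝ} (ht0 : 0 < t) (ht1 : t < 1) (B C : Finset Pt) :
    Prod.mk t ⁻¹' convexHull ℝ (toR3 '' (cayley3 B C : Set Pt3)) = mixedHull t B C := by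
  rw [toR3_image_cayley3, mixedHull, planeHull, planeHull]
  rcases B.eq_empty_or_nonempty with rfl | hB
  · ext y
    simp [convexHull_prod, ht0.ne']
  rcases C.eq_empty_or_nonempty with rfl | hC
  · ext y
    simp [convexHull_prod, ht1.ne]
  rw [convexHull_union ((Set.singleton_nonempty _).prod (hB.to_set.image _))
    ((Set.singleton_nonempty _).prod (hC.to_set.image _)), convexHull_prod, convexHull_prod,
    convexHull_singleton, convexHull_singleton]
  ext y
  rw [Set.mem_preimage, mem_convexJoin, Set.mem_add]
  constructor
  · rintro ⟨⟨a₁, a⟩, ⟨ha₁, ha⟩, ⟨c₁, c⟩, ⟨hc₁, hc⟩, r, s, -, -, hrs, h⟩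
    simp only [Set.mem_singleton_iff] at ha₁ hc₁ ha hc
    subst ha₁ hc₁
    simp only [Prod.smul_mk, Prod.mk_add_mk, Prod.mk.injEq, smul_eq_mul, mul_one, mul_zero,
      add_zero] at h
    obtain ⟨rfl, rfl⟩ := h
    obtain rfl : s = 1 - r := by linarith
    exact ⟨_, Set.smul_mem_smul_set ha, _, Set.smul_mem_smul_set hc, rfl⟩
  · rintro ⟨_, ⟨a, ha, rfl⟩, _, ⟨c, hc, rfl⟩, rfl⟩
    refine ⟨(1, a), ⟨rfl, ha⟩, (0, c), ⟨rfl, hc⟩, t, 1 - t, ht0.le, by linarith, by ring, ?_⟩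
    simp

lemma fst_mem_Icc_of_mem_convexHull_cayley3 {B C : Finset Pt} {z : ℝ × ℝ × ℝ}
    (hz : z ∈ convexHull ℝ (toR3 '' (cayley3 B C : Set Pt3))) : z.1 ∈ Set.Icc (0 : ℝ) 1 := by
  have hsub : convexHull ℝ (toR3 '' (cayley3 B C : Set Pt3)) ⊆
      (LinearMap.fst ℝ ℝ (ℝ × ℝ)) ⁻¹' Set.Icc (0 : ℝ) 1 := by
    refine convexHull_min ?_ ((convex_Icc (0 : ℝ) 1).linear_preimage _)
    rw [toR3_image_cayley3]
    rintro ⟨x, y⟩ (⟨hx, -⟩ | ⟨hx, -⟩) <;> simp at hx <;> simp [hx]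
  exact hsub hz

lemma isCompact_convexHull_toR3 (S : Finset Pt3) :
    IsCompact (convexHull ℝ (toR3 '' (S : Set Pt3))) :=
  (S.finite_toSet.image _).isCompact_convexHull ℝ

lemma isCompact_planeHull (B : Finset Pt) : IsCompact (planeHull B) :=
  (B.finite_toSet.image _).isCompact_convexHull ℝ

lemma volume_convexHull_cayley3 (B C : Finset Pt) :
    volume (convexHull ℝ (toR3 '' (cayley3 B C : Set Pt3))) =
      ∫⁻ t in Set.Ioo (0 : ℝ) 1, volume (mixedHull t B C) := by
  rw [Measure.volume_eq_prod,
    Measure.prod_apply (isCompact_convexHull_toR3 _).isClosed.measurableSet,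
    setLIntegral_congr Ioo_ae_eq_Icc, ← lintegral_indicator measurableSet_Icc]
  have hae : ∀ᵐ t : ℝ, t ≠ 0 ∧ t ≠ 1 := by
    rw [Filter.eventually_and]
    exact ⟨Measure.ae_ne volume 0, Measure.ae_ne volume 1⟩
  refine lintegral_congr_ae ?_
  filter_upwards [hae] with t ht
  by_cases h : t ∈ Set.Icc (0 : ℝ) 1
  · rw [Set.indicator_of_mem h, slice_convexHull_cayley3 (lt_of_le_of_ne h.1 ht.1.symm)
      (lt_of_le_of_ne h.2 ht.2)]
  · rw [Set.indicator_of_notMem h]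
    convert measure_empty
    · refine Set.eq_empty_of_forall_notMem fun y hy => h ?_
      exact fst_mem_Icc_of_mem_convexHull_cayley3 hy
    · infer_instance

lemma nvol3_cayley3_of_volume_mixedHull {B C : Finset Pt} {c : ℝ} {g : ℝ → ℝ}
    (hg : Continuous g) (hc : 0 ≤ c) (hg0 : ∀ t ∈ Set.Ioo (0 : ℝ) 1, 0 ≤ g t)
    (h : ∀ t ∈ Set.Ioo (0 : ℝ) 1, volume (mixedHull t B C) = ENNReal.ofReal (c * g t)) :
    nvol3 (cayley3 B C) = 6 * (c * ∫ t in (0 : ℝ)..1, g t) := by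
  have hint : IntegrableOn (fun t => c * g t) (Set.Ioo (0 : ℝ) 1) :=
    ((continuous_const.mul hg).integrableOn_Icc).mono_set Set.Ioo_subset_Icc_self
  have hnn : 0 ≤ᵐ[volume.restrict (Set.Ioo (0 : ℝ) 1)] fun t => c * g t :=
    (ae_restrict_iff' measurableSet_Ioo).2 (ae_of_all _ fun t ht => mul_nonneg hc (hg0 t ht))
  rw [nvol3, volume_convexHull_cayley3, setLIntegral_congr_fun measurableSet_Ioo h,
    ← ofReal_integral_eq_lintegral_ofReal hint hnn,
    ENNReal.toReal_ofReal (integral_nonneg_of_ae hnn), integral_const_mul,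
    intervalIntegral.integral_of_le zero_le_one, integral_Ioc_eq_integral_Ioo]

lemma volume_smul_segment_add_smul_segment {s r : ℝ} (hs : 0 ≤ s) (hr : 0 ≤ r)
    (a b c d : ℝ × ℝ) :
    volume (s • segment ℝ a b + r • segment ℝ c d) = ENNReal.ofReal
      (|(b.1 - a.1) * (d.2 - c.2) - (b.2 - a.2) * (d.1 - c.1)| * (s * r)) := by
  let L : ℝ × ℝ →ₗ[ℝ] ℝ × ℝ :=
    (LinearMap.toSpanSingleton ℝ (ℝ × ℝ) (s • (b - a))).coprod
      (LinearMap.toSpanSingleton ℝ (ℝ × ℝ) (r • (d - c)))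
  have himg : s • segment ℝ a b + r • segment ℝ c d =
      (s • a + r • c) +ᵥ (L '' (Set.Icc (0 : ℝ) 1 ×ˢ Set.Icc (0 : ℝ) 1)) := by
    rw [segment_eq_image', segment_eq_image']
    ext y
    simp only [Set.mem_add, Set.mem_vadd_set, Set.mem_smul_set, Set.mem_image, Set.mem_prod]
    constructor
    · rintro ⟨_, ⟨_, ⟨x, hx, rfl⟩, rfl⟩, _, ⟨_, ⟨z, hz, rfl⟩, rfl⟩, rfl⟩
      refine ⟨L (x, z), ⟨(x, z), ⟨hx, hz⟩, rfl⟩, ?_⟩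
      simp only [L, LinearMap.coprod_apply, LinearMap.toSpanSingleton_apply, vadd_eq_add]
      module
    · rintro ⟨_, ⟨⟨x, z⟩, ⟨hx, hz⟩, rfl⟩, rfl⟩
      refine ⟨_, ⟨_, ⟨x, hx, rfl⟩, rfl⟩, _, ⟨_, ⟨z, hz, rfl⟩, rfl⟩, ?_⟩
      simp only [L, LinearMap.coprod_apply, LinearMap.toSpanSingleton_apply, vadd_eq_add]
      module
  have hdet : LinearMap.det L =
      ((b.1 - a.1) * (d.2 - c.2) - (b.2 - a.2) * (d.1 - c.1)) * (s * r) := by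
    rw [← LinearMap.det_toMatrix (Module.Basis.finTwoProd ℝ), Matrix.det_fin_two]
    simp [LinearMap.toMatrix_apply, L]
    ring
  have hsq : volume (Set.Icc (0 : ℝ) 1 ×ˢ Set.Icc (0 : ℝ) 1) = 1 := by
    rw [Measure.volume_eq_prod, Measure.prod_prod]
    simp
  rw [himg, measure_vadd, Measure.addHaar_image_linearMap, hdet, hsq, mul_one, abs_mul,
    abs_of_nonneg (mul_nonneg hs hr)]

lemma volume_smul_add_singleton {s : ℝ} (K : Set (ℝ × ℝ)) (p : ℝ × ℝ) :
    volume (s • K + {p}) = ENNReal.ofReal (s ^ 2) * volume K := by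
  rw [Set.add_singleton, Set.image_add_right, measure_preimage_add_right, Measure.addHaar_smul]
  simp

lemma mixedHull_symm (t : ℝ) (B C : Finset Pt) : mixedHull t B C = mixedHull (1 - t) C B := by
  rw [mixedHull, mixedHull, add_comm, sub_sub_cancel]

lemma planeHull_of_card_eq_one {B : Finset Pt} (h : B.card = 1) : ∃ p, planeHull B = {p} := by
  obtain ⟨b, rfl⟩ := Finset.card_eq_one.1 h
  exact ⟨toR2 b, by simp [planeHull]⟩

lemma planeHull_of_card_eq_two {B : Finset Pt} (h : B.card = 2) :
    ∃ p q, planeHull B = segment ℝ p q := by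
  obtain ⟨b, c, -, rfl⟩ := Finset.card_eq_two.1 h
  exact ⟨toR2 b, toR2 c, by simp [planeHull, Set.image_pair, convexHull_pair]⟩

lemma mixedHull_of_card_eq_zero {B : Finset Pt} (h : B.card = 0) (t : ℝ) (C : Finset Pt) :
    mixedHull t B C = ∅ := by
  simp [mixedHull, planeHull, Finset.card_eq_zero.1 h]

lemma volume_mixedHull_of_card_eq_one {C : Finset Pt} (hC : C.card = 1) (t : ℝ) (B : Finset Pt) :
    volume (mixedHull t B C) = ENNReal.ofReal (narea B / 2 * t ^ 2) := by
  obtain ⟨p, hp⟩ := planeHull_of_card_eq_one hC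
  rw [mixedHull, hp, Set.smul_set_singleton, volume_smul_add_singleton, narea,
    mul_div_cancel_left₀ _ two_ne_zero, mul_comm, ENNReal.ofReal_mul ENNReal.toReal_nonneg,
    ← planeHull, ENNReal.ofReal_toReal (isCompact_planeHull B).measure_lt_top.ne]

lemma exists_volume_mixedHull_of_card_eq_two {B C : Finset Pt} (hB : B.card = 2)
    (hC : C.card = 2) : ∃ c : ℝ, 0 ≤ c ∧ ∀ t ∈ Set.Ioo (0 : ℝ) 1,
      volume (mixedHull t B C) = ENNReal.ofReal (c * (t * (1 - t))) := by
  obtain ⟨a, b, hab⟩ := planeHull_of_card_eq_two hB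
  obtain ⟨c, d, hcd⟩ := planeHull_of_card_eq_two hC
  refine ⟨|(b.1 - a.1) * (d.2 - c.2) - (b.2 - a.2) * (d.1 - c.1)|, abs_nonneg _,
    fun t ht => ?_⟩
  rw [mixedHull, hab, hcd]
  exact volume_smul_segment_add_smul_segment ht.1.le (by linarith [ht.2]) a b c d

lemma narea_nonneg (B : Finset Pt) : 0 ≤ narea B :=
  mul_nonneg zero_le_two ENNReal.toReal_nonneg

lemma narea_eq_zero_of_card_le_two {B : Finset Pt} (h : B.card ≤ 2) : narea B = 0 := by
  have key : ∀ p q : ℝ × ℝ, volume (segment ℝ p q) = 0 := fun p q => by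
    simpa using volume_smul_segment_add_smul_segment zero_le_one zero_le_one p q 0 0
  have : volume (planeHull B) = 0 := by
    interval_cases hB : B.card
    · simp [planeHull, Finset.card_eq_zero.1 hB]
    · obtain ⟨p, hp⟩ := planeHull_of_card_eq_one hB
      simp [hp]
    · obtain ⟨p, q, hpq⟩ := planeHull_of_card_eq_two hB
      rw [hpq, key]
  rw [planeHull] at this
  simp [narea, this]

lemma volume_mixedHull_eq_zero {B C : Finset Pt} (h : B.card + C.card ≤ 3) (t : ℝ) :
    volume (mixedHull t B C) = 0 := by
  by_cases hC : C.card ≤ 1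
  · interval_cases hC' : C.card
    · rw [mixedHull_symm, mixedHull_of_card_eq_zero hC', measure_empty]
    · rw [volume_mixedHull_of_card_eq_one hC', narea_eq_zero_of_card_le_two (by omega)]
      simp
  · have hB : B.card ≤ 1 := by omega
    interval_cases hB' : B.card
    · rw [mixedHull_of_card_eq_zero hB', measure_empty]
    · rw [mixedHull_symm, volume_mixedHull_of_card_eq_one hB',
        narea_eq_zero_of_card_le_two (by omega)]
      simp

lemma nvol3_cayley3_of_forall_mixedHull_eq_empty {B C : Finset Pt}
    (h : ∀ t, mixedHull t B C = ∅) : nvol3 (cayley3 B C) = 0 := by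
  simp [nvol3, volume_convexHull_cayley3, h]

/-- The area of the slice at height `t` of a lattice simplex of unit normalized volume with `k`
vertices at height `1` and `4 - k` vertices at height `0`. -/
def sliceWeight (k : ℕ) (t : ℝ) : ℝ :=
  (if k = 3 then t ^ 2 / 2 else 0) + (if k = 2 then t * (1 - t) else 0) +
    (if k = 1 then (1 - t) ^ 2 / 2 else 0)

lemma nvol3_cayley3_eq_zero {B C : Finset Pt} (h : B.card = 0 ∨ C.card = 0) :
    nvol3 (cayley3 B C) = 0 := by
  refine nvol3_cayley3_of_forall_mixedHull_eq_empty fun t => ?_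
  rcases h with h | h
  · exact mixedHull_of_card_eq_zero h t C
  · rw [mixedHull_symm, mixedHull_of_card_eq_zero h]

lemma volume_mixedHull_toReal {B C : Finset Pt} (h : B.card + C.card = 4) {t : ℝ}
    (ht : t ∈ Set.Ioo (0 : ℝ) 1) :
    (volume (mixedHull t B C)).toReal = nvol3 (cayley3 B C) * sliceWeight B.card t := by
  have hB4 : B.card ≤ 4 := by omega
  have ht1 : 0 ≤ 1 - t := by linarith [ht.2]
  have ht0 := ht.1.le
  interval_cases hB : B.card
  · rw [mixedHull_of_card_eq_zero hB]
    simp [sliceWeight]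
  · have hn := nvol3_cayley3_of_volume_mixedHull (B := B) (C := C) (g := fun t => (1 - t) ^ 2)
      (by fun_prop) (div_nonneg (narea_nonneg C) zero_le_two) (fun t _ => sq_nonneg _)
      fun t _ => by rw [mixedHull_symm, volume_mixedHull_of_card_eq_one hB]
    have hi : ∫ t in (0 : ℝ)..1, (1 - t) ^ 2 = 1 / 3 := by
      rw [intervalIntegral.integral_comp_sub_left (fun t => t ^ 2) 1]
      norm_num
    rw [mixedHull_symm, volume_mixedHull_of_card_eq_one hB, hn, hi,
      ENNReal.toReal_ofReal (by have := narea_nonneg C; positivity)]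
    simp [sliceWeight]
    ring
  · obtain ⟨c, hc, hv⟩ := exists_volume_mixedHull_of_card_eq_two hB (by omega : C.card = 2)
    have hn := nvol3_cayley3_of_volume_mixedHull (B := B) (C := C) (g := fun t => t * (1 - t))
      (by fun_prop) hc (fun t ht => mul_nonneg ht.1.le (by linarith [ht.2])) hv
    have hi : ∫ t in (0 : ℝ)..1, t * (1 - t) = 1 / 6 := by
      simp_rw [mul_sub, mul_one, ← sq]
      rw [intervalIntegral.integral_sub (by simp) (by simp)]
      norm_num
    rw [hv t ht, hn, hi, ENNReal.toReal_ofReal (by positivity),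
      show sliceWeight 2 t = t * (1 - t) by simp [sliceWeight]]
    ring
  · have hC : C.card = 1 := by omega
    have hn := nvol3_cayley3_of_volume_mixedHull (B := B) (C := C) (g := fun t => t ^ 2)
      (by fun_prop) (div_nonneg (narea_nonneg B) zero_le_two) (fun t _ => sq_nonneg _)
      fun t _ => volume_mixedHull_of_card_eq_one hC t B
    rw [volume_mixedHull_of_card_eq_one hC, hn,
      ENNReal.toReal_ofReal (by have := narea_nonneg B; positivity)]
    simp [sliceWeight]
    ring
  · rw [mixedHull_symm, mixedHull_of_card_eq_zero (by omega : C.card = 0)]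
    simp [sliceWeight]

/-- The points of a configuration at height `i`, as a planar configuration. -/
def layer (i : ℤ) (σ : Finset Pt3) : Finset Pt := (σ.filter fun α => α.1 = i).image Prod.snd

lemma card_layer (i : ℤ) (σ : Finset Pt3) :
    (layer i σ).card = (σ.filter fun α => α.1 = i).card := by
  refine Finset.card_image_of_injOn fun α hα γ hγ h => ?_
  have hα' := (Finset.mem_filter.1 (Finset.mem_coe.1 hα)).2
  have hγ' := (Finset.mem_filter.1 (Finset.mem_coe.1 hγ)).2
  exact Prod.ext (hα'.trans hγ'.symm) h

lemma fst_of_mem_cayley3 {A₁ A₂ : Finset Pt} {α : Pt3} (h : α ∈ cayley3 A₁ A₂) :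
    α.1 = 1 ∨ α.1 = 0 := by
  simp only [cayley3, Finset.mem_union, Finset.mem_image] at h
  rcases h with ⟨a, -, rfl⟩ | ⟨a, -, rfl⟩
  · exact Or.inl rfl
  · exact Or.inr rfl

lemma cayley3_layer {A₁ A₂ : Finset Pt} {σ : Finset Pt3} (h : σ ⊆ cayley3 A₁ A₂) :
    cayley3 (layer 1 σ) (layer 0 σ) = σ := by
  ext ⟨x, y⟩
  simp only [cayley3, layer, Finset.mem_union, Finset.mem_image, Finset.mem_filter, Prod.exists,
    Prod.mk.injEq]
  constructor
  · rintro (⟨a, b, ⟨⟨c, d, e⟩, hm, hh⟩, rfl, h'⟩ | ⟨a, b, ⟨⟨c, d, e⟩, hm, hh⟩, rfl, h'⟩) <;> grind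
  · intro hm
    rcases fst_of_mem_cayley3 (h hm) with h1 | h1 <;> simp only at h1 <;> subst h1
    · exact Or.inl ⟨y.1, y.2, ⟨1, y.1, y.2, ⟨hm, rfl⟩, rfl, rfl⟩, rfl, rfl⟩
    · exact Or.inr ⟨y.1, y.2, ⟨0, y.1, y.2, ⟨hm, rfl⟩, rfl, rfl⟩, rfl, rfl⟩

lemma card_layer_add_card_layer {A₁ A₂ : Finset Pt} {σ : Finset Pt3} (h : σ ⊆ cayley3 A₁ A₂) :
    (layer 1 σ).card + (layer 0 σ).card = σ.card := by
  rw [card_layer, card_layer, ← Finset.card_filter_add_card_filter_not (s := σ) fun α => α.1 = 1]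
  congr 2
  refine Finset.filter_congr fun α hα => ?_
  rcases fst_of_mem_cayley3 (h hα) with h1 | h1 <;> simp [h1]

lemma volume_mixedHull_eq_sum {A₁ A₂ : Finset Pt} {T : Finset (Finset Pt3)}
    (hT : IsTriangulation3 (cayley3 A₁ A₂) T) {t : ℝ} (ht : t ∈ Set.Ioo (0 : ℝ) 1) :
    (volume (mixedHull t A₁ A₂)).toReal =
      ∑ σ ∈ T, nvol3 σ * sliceWeight (layer 1 σ).card t := by
  obtain ⟨hsimp, hcover, hinter⟩ := hT
  have hslice : ∀ σ ⊆ cayley3 A₁ A₂, Prod.mk t ⁻¹' convexHull ℝ (toR3 '' (σ : Set Pt3)) =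
      mixedHull t (layer 1 σ) (layer 0 σ) := fun σ hσ => by
    conv_lhs => rw [← cayley3_layer hσ]
    exact slice_convexHull_cayley3 ht.1 ht.2 _ _
  have hunion : mixedHull t A₁ A₂ =
      ⋃ σ ∈ T, Prod.mk t ⁻¹' convexHull ℝ (toR3 '' (σ : Set Pt3)) := by
    rw [← slice_convexHull_cayley3 ht.1 ht.2, ← hcover]
    simp only [Set.preimage_iUnion]
  rw [hunion, measure_biUnion_finset₀, ENNReal.toReal_sum]
  · refine Finset.sum_congr rfl fun σ hσ => ?_
    obtain ⟨hσA, hcard, -⟩ := hsimp σ hσ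
    rw [hslice σ hσA, volume_mixedHull_toReal
      ((card_layer_add_card_layer hσA).trans hcard) ht, cayley3_layer hσA]
  · intro σ hσ
    rw [hslice σ (hsimp σ hσ).1]
    exact (((isCompact_planeHull _).smul _).add ((isCompact_planeHull _).smul _)).measure_lt_top.ne
  · intro σ hσ τ hτ hne
    obtain ⟨hσA, hσcard, -⟩ := hsimp σ hσ
    obtain ⟨-, hτcard, -⟩ := hsimp τ hτ
    have hsub : σ ∩ τ ⊆ cayley3 A₁ A₂ := Finset.inter_subset_left.trans hσA
    have hlt : (σ ∩ τ).card < 4 := by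
      rw [← hσcard]
      refine Finset.card_lt_card (Finset.inter_subset_left.ssubset_of_ne fun h => hne ?_)
      exact Finset.eq_of_subset_of_card_le (Finset.inter_eq_left.1 h) (by omega)
    change volume (_ ∩ _) = 0
    rw [← Set.preimage_inter, hinter σ hσ τ hτ, hslice _ hsub]
    refine volume_mixedHull_eq_zero ?_ t
    rw [card_layer_add_card_layer hsub]
    omega
  · intro σ _
    exact ((isCompact_convexHull_toR3 σ).isClosed.preimage
      (by fun_prop)).measurableSet.nullMeasurableSet

lemma tendsto_volume_mixedHull (A₁ : Finset Pt) {A₂ : Finset Pt} (h₂ : A₂.Nonempty) :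
    Filter.Tendsto (fun t => (volume (mixedHull t A₁ A₂)).toReal) (nhdsWithin 1 (Set.Iio 1))
      (nhds (narea A₁ / 2)) := by
  have hfin : volume (planeHull A₁) ≠ ⊤ := (isCompact_planeHull A₁).measure_lt_top.ne
  rw [show narea A₁ / 2 = (volume (planeHull A₁)).toReal from
    mul_div_cancel_left₀ _ two_ne_zero]
  refine (ENNReal.tendsto_toReal hfin).comp ?_
  have hbdd := ((isCompact_planeHull A₁).union (isCompact_planeHull A₂)).isBounded
  set R := Metric.diam (planeHull A₁ ∪ planeHull A₂)
  have hlower : Filter.Tendsto (fun t : ℝ => ENNReal.ofReal (t ^ 2) * volume (planeHull A₁))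
      (nhdsWithin 1 (Set.Iio 1)) (nhds (volume (planeHull A₁))) := by
    have h1 : Filter.Tendsto (fun t : ℝ => ENNReal.ofReal (t ^ 2)) (nhdsWithin 1 (Set.Iio 1))
        (nhds (ENNReal.ofReal (1 ^ 2))) :=
      (ENNReal.tendsto_ofReal (Continuous.tendsto (by fun_prop) 1)).mono_left nhdsWithin_le_nhds
    simpa using ENNReal.Tendsto.mul_const h1 (Or.inr hfin)
  have hupper : Filter.Tendsto
      (fun t : ℝ => volume (Metric.cthickening ((1 - t) * R) (planeHull A₁)))
      (nhdsWithin 1 (Set.Iio 1)) (nhds (volume (planeHull A₁))) := by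
    refine (tendsto_measure_cthickening_of_isCompact (isCompact_planeHull A₁)).comp ?_
    have h1 : Filter.Tendsto (fun t : ℝ => (1 - t) * R) (nhdsWithin 1 (Set.Iio 1))
        (nhds ((1 - 1) * R)) :=
      (Continuous.tendsto (by fun_prop) 1).mono_left nhdsWithin_le_nhds
    simpa using h1
  refine tendsto_of_tendsto_of_tendsto_of_le_of_le' hlower hupper ?_ ?_
  · obtain ⟨c, hc⟩ := h₂
    have hc' : toR2 c ∈ planeHull A₂ := subset_convexHull ℝ _ ⟨c, hc, rfl⟩
    refine Filter.Eventually.of_forall fun t => ?_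
    rw [← volume_smul_add_singleton _ ((1 - t) • toR2 c)]
    exact measure_mono (Set.add_subset_add_left
      (Set.singleton_subset_iff.2 (Set.smul_mem_smul_set hc')))
  · filter_upwards [self_mem_nhdsWithin] with t ht
    refine measure_mono ?_
    rintro _ ⟨_, ⟨p, hp, rfl⟩, _, ⟨q, hq, rfl⟩, rfl⟩
    refine Metric.mem_cthickening_of_dist_le _ p _ _ hp ?_
    have hpq := Metric.dist_le_diam_of_mem hbdd (Or.inr hq) (Or.inl hp)
    have ht' : 0 ≤ 1 - t := sub_nonneg.2 (le_of_lt ht)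
    rw [dist_eq_norm] at hpq ⊢
    rw [show t • p + (1 - t) • q - p = (1 - t) • (q - p) by module, norm_smul,
      Real.norm_of_nonneg ht']
    exact mul_le_mul_of_nonneg_left hpq ht'

/-- The total normalized volume of the simplices with `k` vertices at height `1`. -/
def typeVolume (T : Finset (Finset Pt3)) (k : ℕ) : ℝ :=
  ∑ σ ∈ T, if (layer 1 σ).card = k then nvol3 σ else 0

lemma sum_nvol3_mul_sliceWeight (T : Finset (Finset Pt3)) (t : ℝ) :
    ∑ σ ∈ T, nvol3 σ * sliceWeight (layer 1 σ).card t =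
      typeVolume T 3 * (t ^ 2 / 2) + typeVolume T 2 * (t * (1 - t)) +
        typeVolume T 1 * ((1 - t) ^ 2 / 2) := by
  simp only [typeVolume, Finset.sum_mul, ← Finset.sum_add_distrib]
  refine Finset.sum_congr rfl fun σ _ => ?_
  simp only [sliceWeight, mul_add, mul_ite, ite_mul, mul_zero, zero_mul]

lemma typeVolume_three {A₁ A₂ : Finset Pt} (h₂ : A₂.Nonempty) {T : Finset (Finset Pt3)}
    (hT : IsTriangulation3 (cayley3 A₁ A₂) T) : typeVolume T 3 = narea A₁ := by
  have h : Filter.Tendsto (fun t : ℝ => typeVolume T 3 * (t ^ 2 / 2) +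
      typeVolume T 2 * (t * (1 - t)) + typeVolume T 1 * ((1 - t) ^ 2 / 2))
      (nhdsWithin 1 (Set.Iio 1)) (nhds (typeVolume T 3 * (1 ^ 2 / 2) +
      typeVolume T 2 * (1 * (1 - 1)) + typeVolume T 1 * ((1 - 1) ^ 2 / 2))) :=
    (Continuous.tendsto (by fun_prop) 1).mono_left nhdsWithin_le_nhds
  have heq := tendsto_nhds_unique_of_eventuallyEq (tendsto_volume_mixedHull A₁ h₂) h (by
    filter_upwards [Ioo_mem_nhdsLT (zero_lt_one' ℝ)] with t ht
    rw [volume_mixedHull_eq_sum hT ht, sum_nvol3_mul_sliceWeight])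
  norm_num at heq
  linarith

lemma typeVolume_one {A₁ A₂ : Finset Pt} (h₁ : A₁.Nonempty) {T : Finset (Finset Pt3)}
    (hT : IsTriangulation3 (cayley3 A₁ A₂) T) : typeVolume T 1 = narea A₂ := by
  have h : Filter.Tendsto (fun t : ℝ => typeVolume T 3 * ((1 - t) ^ 2 / 2) +
      typeVolume T 2 * ((1 - t) * (1 - (1 - t))) + typeVolume T 1 * ((1 - (1 - t)) ^ 2 / 2))
      (nhdsWithin 1 (Set.Iio 1)) (nhds (typeVolume T 3 * ((1 - 1) ^ 2 / 2) +
      typeVolume T 2 * ((1 - 1) * (1 - (1 - 1))) + typeVolume T 1 * ((1 - (1 - 1)) ^ 2 / 2))) :=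
    (Continuous.tendsto (by fun_prop) 1).mono_left nhdsWithin_le_nhds
  have heq := tendsto_nhds_unique_of_eventuallyEq (tendsto_volume_mixedHull A₂ h₁) h (by
    filter_upwards [Ioo_mem_nhdsLT (zero_lt_one' ℝ)] with t ht
    rw [mixedHull_symm, volume_mixedHull_eq_sum hT ⟨by linarith [ht.2], by linarith [ht.1]⟩,
      sum_nvol3_mul_sliceWeight])
  norm_num at heq
  linarith

lemma volume_mixedHull_half (A₁ A₂ : Finset Pt) :
    (volume (mixedHull (1 / 2) A₁ A₂)).toReal = narea (A₁ + A₂) / 8 := by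
  have hadd : toR2 '' ((A₁ + A₂ : Finset Pt) : Set Pt) =
      toR2 '' (A₁ : Set Pt) + toR2 '' (A₂ : Set Pt) := by
    rw [Finset.coe_add]
    exact Set.image_add (⟨⟨toR2, by simp [toR2]⟩, fun a b => by simp [toR2]⟩ : Pt →+ ℝ × ℝ)
  have hmix : mixedHull (1 / 2) A₁ A₂ =
      (1 / 2 : ℝ) • convexHull ℝ (toR2 '' ((A₁ + A₂ : Finset Pt) : Set Pt)) := by
    rw [hadd, convexHull_add, smul_add, mixedHull, planeHull, planeHull]
    norm_num
  rw [hmix, Measure.addHaar_smul, ENNReal.toReal_mul, ENNReal.toReal_ofReal (abs_nonneg _), narea]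
  norm_num
  ring

lemma typeVolume_two {A₁ A₂ : Finset Pt} (h₁ : A₁.Nonempty) (h₂ : A₂.Nonempty)
    {T : Finset (Finset Pt3)} (hT : IsTriangulation3 (cayley3 A₁ A₂) T) :
    typeVolume T 2 = mvol A₁ A₂ := by
  have h := volume_mixedHull_eq_sum hT (t := 1 / 2) ⟨by norm_num, by norm_num⟩
  rw [sum_nvol3_mul_sliceWeight, volume_mixedHull_half, typeVolume_three h₂ hT,
    typeVolume_one h₁ hT] at h
  rw [mvol]
  norm_num at h
  linarith

lemma sum_gkzVector_layer {A : Finset Pt3} {T : Finset (Finset Pt3)} (hT : ∀ σ ∈ T, σ ⊆ A)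
    (i : ℤ) :
    ∑ α : {x // x ∈ A}, (if α.1.1 = i then gkzVector A T α else 0) =
      ∑ σ ∈ T, (layer i σ).card * nvol3 σ := by
  simp only [gkzVector, Finset.sum_filter]
  rw [Finset.sum_coe_sort A fun α =>
    if α.1 = i then ∑ σ ∈ T, if α ∈ σ then nvol3 σ else 0 else 0, ← Finset.sum_filter,
    Finset.sum_comm]
  refine Finset.sum_congr rfl fun σ hσ => ?_
  rw [← Finset.sum_filter, Finset.sum_const, nsmul_eq_mul, card_layer, Finset.filter_filter]
  congr 3
  ext α
  simp only [Finset.mem_filter]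
  exact ⟨fun h => ⟨h.2.2, h.2.1⟩, fun h => ⟨hT σ hσ h.1, h.2, h.1⟩⟩

lemma nvol3_eq_zero_of_card_layer {A₁ A₂ : Finset Pt} {σ : Finset Pt3}
    (hσ : σ ⊆ cayley3 A₁ A₂) (h : (layer 1 σ).card = 0 ∨ (layer 0 σ).card = 0) :
    nvol3 σ = 0 := by
  rw [← cayley3_layer hσ]
  exact nvol3_cayley3_eq_zero h

lemma sum_card_layer_mul_nvol3 {A₁ A₂ : Finset Pt} {T : Finset (Finset Pt3)}
    (hT : IsTriangulation3 (cayley3 A₁ A₂) T) :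
    ∑ σ ∈ T, (layer 1 σ).card * nvol3 σ =
        3 * typeVolume T 3 + 2 * typeVolume T 2 + typeVolume T 1 ∧
      ∑ σ ∈ T, (layer 0 σ).card * nvol3 σ =
        typeVolume T 3 + 2 * typeVolume T 2 + 3 * typeVolume T 1 := by
  simp only [typeVolume, Finset.mul_sum, ← Finset.sum_add_distrib]
  constructor <;> refine Finset.sum_congr rfl fun σ hσ => ?_ <;>
  · obtain ⟨hσA, hcard, -⟩ := hT.1 σ hσ
    have hadd := (card_layer_add_card_layer hσA).trans hcard
    have hzero := nvol3_eq_zero_of_card_layer hσA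
    obtain ⟨k, hk⟩ : ∃ k, (layer 1 σ).card = k := ⟨_, rfl⟩
    have hk4 : k ≤ 4 := by omega
    have h0 : (layer 0 σ).card = 4 - k := by omega
    rw [hk, h0] at hzero
    simp only [hk, h0]
    interval_cases k <;> simp_all

lemma sum_gkzVector {A₁ A₂ : Finset Pt} (h₁ : A₁.Nonempty) (h₂ : A₂.Nonempty)
    {T : Finset (Finset Pt3)} (hT : IsTriangulation3 (cayley3 A₁ A₂) T) :
    ∑ α : {x // x ∈ cayley3 A₁ A₂},
        (if α.1.1 = 1 then gkzVector (cayley3 A₁ A₂) T α else 0) =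
        3 * narea A₁ + narea A₂ + 2 * mvol A₁ A₂ ∧
      ∑ α : {x // x ∈ cayley3 A₁ A₂},
        (if α.1.1 = 0 then gkzVector (cayley3 A₁ A₂) T α else 0) =
        narea A₁ + 3 * narea A₂ + 2 * mvol A₁ A₂ := by
  rw [sum_gkzVector_layer (fun σ hσ => (hT.1 σ hσ).1),
    sum_gkzVector_layer (fun σ hσ => (hT.1 σ hσ).1), (sum_card_layer_mul_nvol3 hT).1,
    (sum_card_layer_mul_nvol3 hT).2, typeVolume_three h₂ hT, typeVolume_two h₁ h₂ hT,
    typeVolume_one h₁ hT]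
  constructor <;> ring

/-- If a coordinate-block sum is constant on the generators of the secondary polytope, it is the
block degree of every polynomial with that Newton polytope. -/
lemma cblockDeg_eq_of_newtonPolytope_eq {A : Finset Pt3} {E : MvPolynomial {x // x ∈ A} ℤ}
    (hE : newtonPolytope A E = secondaryPolytope A) (hex : ∃ T, IsTriangulation3 A T)
    {i : ℤ} {c : ℝ} (hc : ∀ T, IsTriangulation3 A T →
      ∑ α : {x // x ∈ A}, (if α.1.1 = i then gkzVector A T α else 0) = c) :
    (cblockDeg A i E : ℝ) = c := by
  let f : ({x // x ∈ A} → ℝ) →ₗ[ℝ] ℝ :=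
    ∑ α : {x // x ∈ A}, if α.1.1 = i then LinearMap.proj α else 0
  have hf (φ : {x // x ∈ A} → ℝ) : f φ = ∑ α, if α.1.1 = i then φ α else 0 := by
    simp only [f, LinearMap.sum_apply]
    exact Finset.sum_congr rfl fun α _ => by split_ifs <;> simp
  have hsec : secondaryPolytope A ⊆ f ⁻¹' {c} := by
    refine convexHull_min ?_ ((convex_singleton c).linear_preimage f)
    rintro _ ⟨T, hT, rfl⟩
    rw [Set.mem_preimage, hf]
    exact hc T hT
  have hval : ∀ m ∈ E.support,
      ((m.sum fun α k => if α.1.1 = i then k else 0 : ℕ) : ℝ) = c := by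
    intro m hm
    have hmem : (fun α => ((m α : ℕ) : ℝ)) ∈ newtonPolytope A E :=
      subset_convexHull ℝ _ ⟨m, hm, rfl⟩
    have := hsec (hE ▸ hmem)
    rw [Set.mem_preimage, hf] at this
    rw [Finsupp.sum_fintype _ _ (by simp), ← Set.mem_singleton_iff.1 this]
    push_cast
    rfl
  have hne : E.support.Nonempty := by
    obtain ⟨T, hT⟩ := hex
    have : (newtonPolytope A E).Nonempty :=
      hE ▸ ⟨gkzVector A T, subset_convexHull ℝ _ ⟨T, hT, rfl⟩⟩
    simpa [newtonPolytope] using this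
  obtain ⟨m, hm, hsup⟩ := Finset.exists_mem_eq_sup _ hne
    fun m : {x // x ∈ A} →₀ ℕ => m.sum fun α k => if α.1.1 = i then k else 0
  rw [cblockDeg, hsup]
  exact hval m hm

lemma toR3_injective : Function.Injective toR3 := by
  rintro ⟨a, b, c⟩ ⟨a', b', c'⟩ h
  simpa [toR3] using h

lemma exists_isTriangulation3 {A : Finset Pt3}
    (hA : affineSpan ℝ (toR3 '' (A : Set Pt3)) = ⊤) : ∃ T, IsTriangulation3 A T := by
  classical
  obtain ⟨T', hsimp, hcover, hinter⟩ :=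
    exists_triangulation (A.image toR3) (by rwa [Finset.coe_image])
  refine ⟨A.powerset.filter fun σ : Finset Pt3 => σ.image toR3 ∈ T', ?_, ?_, ?_⟩
  · intro σ hσ
    obtain ⟨hσA, hσT⟩ := Finset.mem_filter.1 hσ
    have hs := (hsimp _ hσT).2
    refine ⟨Finset.mem_powerset.1 hσA, ?_, ?_⟩
    · have := hs.card_eq
      rw [Finset.card_image_of_injective _ toR3_injective] at this
      simpa using this
    · let e : {x // x ∈ σ} ↪ {x // x ∈ σ.image toR3} :=
        ⟨fun x => ⟨toR3 x.1, Finset.mem_image_of_mem _ x.2⟩, fun x y h =>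
          Subtype.ext (toR3_injective (congrArg Subtype.val h))⟩
      exact hs.1.comp_embedding e
  · rw [← Finset.coe_image, ← hcover]
    refine Set.Subset.antisymm (Set.iUnion₂_subset fun σ hσ => ?_)
      (Set.iUnion₂_subset fun σ' hσ' => ?_)
    · rw [← Finset.coe_image]
      exact Set.subset_biUnion_of_mem (u := fun σ : Finset (ℝ × ℝ × ℝ) =>
        convexHull ℝ (σ : Set (ℝ × ℝ × ℝ)))
        (Finset.mem_filter.1 hσ).2
    · obtain ⟨σ, hσA, rfl⟩ := Finset.subset_image_iff.1 (hsimp σ' hσ').1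
      rw [Finset.coe_image]
      exact Set.subset_biUnion_of_mem
        (u := fun σ : Finset Pt3 => convexHull ℝ (toR3 '' (σ : Set Pt3)))
        (Finset.mem_coe.2 (Finset.mem_filter.2
          ⟨Finset.mem_powerset.2 (by exact_mod_cast hσA), hσ'⟩))
  · intro σ hσ τ hτ
    refine Set.Subset.antisymm ?_ (Set.subset_inter ?_ ?_)
    · have := hinter _ (Finset.mem_filter.1 hσ).2 _ (Finset.mem_filter.1 hτ).2
      rwa [Finset.coe_image, Finset.coe_image, ← Set.image_inter toR3_injective,
        ← Finset.coe_inter] at this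
    · exact convexHull_mono (Set.image_mono (by simp))
    · exact convexHull_mono (Set.image_mono (by simp))

lemma FullDim.vectorSpan_eq_top {B : Finset Pt} (h : FullDim B) :
    vectorSpan ℝ (toR2 '' (B : Set Pt)) = ⊤ := by
  refine Submodule.eq_top_of_finrank_eq (le_antisymm (Submodule.finrank_le _) ?_)
  rw [FullDim, collinear_iff_finrank_le_one] at h
  simp
  omega

lemma FullDim.nonempty {B : Finset Pt} (h : FullDim B) : B.Nonempty := by
  rw [Finset.nonempty_iff_ne_empty]
  rintro rfl
  exact h (by simpa using collinear_empty ℝ (ℝ × ℝ))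

lemma affineSpan_cayley3_eq_top {A₁ A₂ : Finset Pt} (h₁ : FullDim A₁) (h₂ : A₂.Nonempty) :
    affineSpan ℝ (toR3 '' (cayley3 A₁ A₂ : Set Pt3)) = ⊤ := by
  obtain ⟨a, ha⟩ := h₁.nonempty
  obtain ⟨b, hb⟩ := h₂
  rw [toR3_image_cayley3]
  set S : Set (ℝ × ℝ × ℝ) :=
    ({1} ×ˢ (toR2 '' (A₁ : Set Pt))) ∪ ({0} ×ˢ (toR2 '' (A₂ : Set Pt)))
  have haS : ((1 : ℝ), toR2 a) ∈ S := Or.inl ⟨rfl, a, ha, rfl⟩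
  have hbS : ((0 : ℝ), toR2 b) ∈ S := Or.inr ⟨rfl, b, hb, rfl⟩
  rw [AffineSubspace.affineSpan_eq_top_iff_vectorSpan_eq_top_of_nonempty ℝ _ _ ⟨_, haS⟩, eq_top_iff]
  have hplane : ∀ y : ℝ × ℝ, ((0 : ℝ), y) ∈ vectorSpan ℝ S := by
    have hle : vectorSpan ℝ (toR2 '' (A₁ : Set Pt)) ≤
        (vectorSpan ℝ S).comap (LinearMap.inr ℝ ℝ (ℝ × ℝ)) := by
      rw [vectorSpan_def, Submodule.span_le]
      rintro _ ⟨p, hp, q, hq, rfl⟩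
      have := vsub_mem_vectorSpan ℝ (s := S) (p₁ := ((1 : ℝ), p)) (p₂ := ((1 : ℝ), q))
        (Or.inl ⟨rfl, hp⟩) (Or.inl ⟨rfl, hq⟩)
      simpa using this
    intro y
    exact hle (h₁.vectorSpan_eq_top ▸ Submodule.mem_top)
  rintro ⟨x, y⟩ -
  have hdir := vsub_mem_vectorSpan ℝ haS hbS
  have := Submodule.add_mem _ (Submodule.smul_mem _ x hdir)
    (hplane (y - x • (toR2 a - toR2 b)))
  simpa using this

/-- **Lemma 3.4.**  The principal `A`-determinant cycle `Ẽ_A` of the Cayley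
configuration `A = Cay(A₁,A₂)` — characterized by the property that its Newton polytope
is the secondary polytope of `A` (with volumes normalized with respect to `ℤ⁴`) — has
bidegree `(3·area(Q₁) + area(Q₂) + 2·MV(Q₁,Q₂), area(Q₁) + 3·area(Q₂) + 2·MV(Q₁,Q₂))`. -/
theorem bidegree_principal_determinant_cycle
    (A₁ A₂ : Finset Pt) (h₁ : FullDim A₁) (h₂ : FullDim A₂)
    (E : MvPolynomial {x // x ∈ cayley3 A₁ A₂} ℤ)
    (hE : newtonPolytope (cayley3 A₁ A₂) E = secondaryPolytope (cayley3 A₁ A₂)) :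
    (cblockDeg (cayley3 A₁ A₂) 1 E : ℝ)
        = 3 * narea A₁ + narea A₂ + 2 * mvol A₁ A₂
    ∧ (cblockDeg (cayley3 A₁ A₂) 0 E : ℝ)
        = narea A₁ + 3 * narea A₂ + 2 * mvol A₁ A₂ := by
  have hex := exists_isTriangulation3 (affineSpan_cayley3_eq_top h₁ h₂.nonempty)
  exact ⟨cblockDeg_eq_of_newtonPolytope_eq hE hex fun T hT =>
      (sum_gkzVector h₁.nonempty h₂.nonempty hT).1,
    cblockDeg_eq_of_newtonPolytope_eq hE hex fun T hT =>
      (sum_gkzVector h₁.nonempty h₂.nonempty hT).2⟩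

end
end

section
/- Let A_1, A_2 be full-dimensional finite configurations in ℤ², let (e,f) be a strongly parallel pair of edges, and let V(e,f) be the corresponding vertical facet of the Cayley configuration A = Cay(A_1,A_2). Then the subdiagram volume satisfies u(V(e,f), A) = min{u(e, A_1), u(f, A_2)}. -/
noncomputable section

abbrev Pt4 : Type := (ℤ × ℤ) × (ℤ × ℤ)

def dotZ (w p : Pt) : ℤ := w.1 * p.1 + w.2 * p.2

/-- `e` is the edge of `A` with primitive inner normal `w`, supported at level `c`. -/
def IsEdgeWith (A : Finset Pt) (w : Pt) (c : ℤ) (e : Finset Pt) : Prop :=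
  Int.gcd w.1 w.2 = 1 ∧ (∀ a ∈ A, c ≤ dotZ w a) ∧
    e = A.filter (fun a => dotZ w a = c) ∧ 2 ≤ e.card

def MinOnIs {α : Type} (s : Finset α) (g : α → ℤ) (m : ℤ) : Prop :=
  (∃ a ∈ s, g a = m) ∧ ∀ a ∈ s, m ≤ g a

/-- the Cayley configuration `Cay(A₁,A₂) ⊂ ℤ⁴`. -/
def cayley4 (A₁ A₂ : Finset Pt) : Finset Pt4 :=
  A₁.image (fun a => ((((1:ℤ),(0:ℤ)) : Pt), a)) ∪
    A₂.image (fun b => ((((0:ℤ),(1:ℤ)) : Pt), b))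

/-- the vertical facet `V(e,f)` of the Cayley configuration, for a strongly parallel
pair of edges `(e,f)`. -/
def vFacet4 (e f : Finset Pt) : Finset Pt4 :=
  e.image (fun a => ((((1:ℤ),(0:ℤ)) : Pt), a)) ∪
    f.image (fun b => ((((0:ℤ),(1:ℤ)) : Pt), b))

/-- an integer linear functional on `ℤ⁴`. -/
def dot4 (φ p : Pt4) : ℤ :=
  φ.1.1 * p.1.1 + φ.1.2 * p.1.2 + φ.2.1 * p.2.1 + φ.2.2 * p.2.2

/-- An integer covector that vanishes on the difference of two distinct points on a line with
primitive normal `w` is an integer multiple of `w`. -/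
theorem exists_eq_mul_of_dotZ_eq {w v a b : Pt} (hw : Int.gcd w.1 w.2 = 1) (hab : a ≠ b)
    (hwab : dotZ w a = dotZ w b) (hvab : dotZ v a = dotZ v b) :
    ∃ k : ℤ, v.1 = k * w.1 ∧ v.2 = k * w.2 := by
  obtain ⟨w₁, w₂⟩ := w
  obtain ⟨v₁, v₂⟩ := v
  obtain ⟨a₁, a₂⟩ := a
  obtain ⟨b₁, b₂⟩ := b
  simp only [dotZ] at *
  obtain ⟨s, t, hst⟩ := Int.isCoprime_iff_gcd_eq_one.mpr hw
  have hdet : v₁ * w₂ - v₂ * w₁ = 0 := by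
    by_contra hne
    have hx : (v₁ * w₂ - v₂ * w₁) * (a₁ - b₁) = 0 := by
      linear_combination w₂ * hvab - v₂ * hwab
    have hy : (v₁ * w₂ - v₂ * w₁) * (a₂ - b₂) = 0 := by
      linear_combination v₁ * hwab - w₁ * hvab
    have hx' := (mul_eq_zero.mp hx).resolve_left hne
    have hy' := (mul_eq_zero.mp hy).resolve_left hne
    exact hab (Prod.ext (sub_eq_zero.mp hx') (sub_eq_zero.mp hy'))
  refine ⟨s * v₁ + t * v₂, ?_, ?_⟩
  · linear_combination t * hdet - v₁ * hst
  · linear_combination (-s) * hdet - v₂ * hst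

/-- The point `(e₁, a)` of the first summand of a Cayley configuration lies in the vertical facet
exactly when `a` lies in the first edge. -/
theorem left_mem_vFacet4 {e f : Finset Pt} {a : Pt} :
    (((1, 0), a) : Pt4) ∈ vFacet4 e f ↔ a ∈ e := by
  simp [vFacet4]

/-- The point `(e₂, b)` of the second summand of a Cayley configuration lies in the vertical facet
exactly when `b` lies in the second edge. -/
theorem right_mem_vFacet4 {e f : Finset Pt} {b : Pt} :
    (((0, 1), b) : Pt4) ∈ vFacet4 e f ↔ b ∈ f := by
  simp [vFacet4]

/-- Membership in the complement of the vertical facet, split over the two summands. -/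
theorem mem_cayley4_sdiff_vFacet4 {A₁ A₂ e f : Finset Pt} {p : Pt4} :
    p ∈ cayley4 A₁ A₂ \ vFacet4 e f ↔
      (∃ a ∈ A₁ \ e, p = ((1, 0), a)) ∨ ∃ b ∈ A₂ \ f, p = ((0, 1), b) := by
  simp only [Finset.mem_sdiff, cayley4, Finset.mem_union, Finset.mem_image]
  constructor
  · rintro ⟨⟨a, ha, rfl⟩ | ⟨b, hb, rfl⟩, hp⟩
    · exact Or.inl ⟨a, ⟨ha, fun h => hp (left_mem_vFacet4.mpr h)⟩, rfl⟩
    · exact Or.inr ⟨b, ⟨hb, fun h => hp (right_mem_vFacet4.mpr h)⟩, rfl⟩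
  · rintro (⟨a, ⟨ha, hae⟩, rfl⟩ | ⟨b, ⟨hb, hbf⟩, rfl⟩)
    · exact ⟨Or.inl ⟨a, ha, rfl⟩, fun h => hae (left_mem_vFacet4.mp h)⟩
    · exact ⟨Or.inr ⟨b, hb, rfl⟩, fun h => hbf (right_mem_vFacet4.mp h)⟩

/-- **Lemma 3.5 (2).**  Let `(e,f)` be a strongly parallel pair of edges (common
primitive inner normal `w`, support levels `c₁, c₂`), let `u₁ = u(e,A₁)` and
`u₂ = u(f,A₂)` be the subdiagram volumes of the edges (the normalized lattice distance
from the line of the edge to the nearest point of the configuration off that line), and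
let `uV = u(V(e,f), A)` be the subdiagram volume of the vertical facet `V(e,f)` of the
Cayley configuration, computed via a primitive integer functional `φ` supporting
`A = Cay(A₁,A₂)` exactly along `V(e,f)`.  Then `u(V(e,f),A) = min{u(e,A₁), u(f,A₂)}`. -/
theorem subdiagram_volume_vertical_facet
    (A₁ A₂ : Finset Pt) (h₁ : FullDim A₁) (h₂ : FullDim A₂)
    (w : Pt) (c₁ c₂ : ℤ) (e f : Finset Pt)
    (he : IsEdgeWith A₁ w c₁ e) (hf : IsEdgeWith A₂ w c₂ f)
    (u₁ u₂ : ℤ)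
    (hu₁ : MinOnIs (A₁ \ e) (dotZ w) (c₁ + u₁))
    (hu₂ : MinOnIs (A₂ \ f) (dotZ w) (c₂ + u₂))
    (φ : Pt4)
    (hprim : ∃ z : Pt4, dot4 φ z = 1)
    (hzero : ∀ p ∈ vFacet4 e f, dot4 φ p = 0)
    (hpos : ∀ p ∈ cayley4 A₁ A₂, 0 ≤ dot4 φ p)
    (hface : ∀ p ∈ cayley4 A₁ A₂, dot4 φ p = 0 → p ∈ vFacet4 e f)
    (uV : ℤ)
    (huV : MinOnIs (cayley4 A₁ A₂ \ vFacet4 e f) (dot4 φ) uV) :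
    uV = min u₁ u₂ := by
  obtain ⟨hw, hA₁, rfl, hecard⟩ := he
  obtain ⟨-, -, rfl, hfcard⟩ := hf
  obtain ⟨a, ha, a', ha', haa'⟩ := Finset.one_lt_card.mp hecard
  obtain ⟨b, hb⟩ := Finset.card_pos.mp (Nat.zero_lt_two.trans_le hfcard)
  have hza := hzero _ (left_mem_vFacet4.mpr ha)
  have hza' := hzero _ (left_mem_vFacet4.mpr ha')
  have hzb := hzero _ (right_mem_vFacet4.mpr hb)
  have hwa := (Finset.mem_filter.mp ha).2
  have hwa' := (Finset.mem_filter.mp ha').2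
  have hwb := (Finset.mem_filter.mp hb).2
  obtain ⟨k, hk₁, hk₂⟩ := exists_eq_mul_of_dotZ_eq (v := φ.2) hw haa' (hwa.trans hwa'.symm)
    (by simp only [dot4, dotZ] at *; linarith)
  obtain ⟨z, hz⟩ := hprim
  obtain ⟨⟨x, hx, hxu⟩, hmin₁⟩ := hu₁
  obtain ⟨⟨y, hy, hyu⟩, hmin₂⟩ := hu₂
  have hφ₁ : φ.1.1 = -(k * c₁) := by
    simp only [dot4, dotZ, hk₁, hk₂] at hza hwa
    linear_combination hza - k * hwa
  have hφ₂ : φ.1.2 = -(k * c₂) := by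
    simp only [dot4, dotZ, hk₁, hk₂] at hzb hwb
    linear_combination hzb - k * hwb
  have hleft (p : Pt) : dot4 φ ((1, 0), p) = k * (dotZ w p - c₁) := by
    simp only [dot4, dotZ, hφ₁, hk₁, hk₂]
    ring
  have hright (p : Pt) : dot4 φ ((0, 1), p) = k * (dotZ w p - c₂) := by
    simp only [dot4, dotZ, hφ₂, hk₁, hk₂]
    ring
  have hkunit : k ∣ 1 := by
    refine ⟨-c₁ * z.1.1 - c₂ * z.1.2 + dotZ w z.2, ?_⟩
    rw [← hz]
    simp only [dot4, dotZ, hφ₁, hφ₂, hk₁, hk₂]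
    ring
  have hxA := (Finset.mem_sdiff.mp hx).1
  have hxlt : c₁ < dotZ w x := lt_of_le_of_ne (hA₁ x hxA) fun h =>
    (Finset.mem_sdiff.mp hx).2 (Finset.mem_filter.mpr ⟨hxA, h.symm⟩)
  have hknonneg : 0 ≤ k := by
    have h := hpos ((1, 0), x) (Finset.mem_union_left _ (Finset.mem_image_of_mem _ hxA))
    rw [hleft] at h
    exact nonneg_of_mul_nonneg_left h (sub_pos.mpr hxlt)
  obtain rfl : k = 1 := Int.eq_one_of_dvd_one hknonneg hkunit
  obtain ⟨⟨p, hp, hpu⟩, hminV⟩ := huV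
  apply le_antisymm
  · have h₁ := hminV _ (mem_cayley4_sdiff_vFacet4.mpr (Or.inl ⟨x, hx, rfl⟩))
    have h₂ := hminV _ (mem_cayley4_sdiff_vFacet4.mpr (Or.inr ⟨y, hy, rfl⟩))
    rw [hleft] at h₁
    rw [hright] at h₂
    exact le_min (by linarith) (by linarith)
  · rcases mem_cayley4_sdiff_vFacet4.mp hp with ⟨q, hq, rfl⟩ | ⟨q, hq, rfl⟩
    · rw [hleft] at hpu
      exact min_le_of_left_le (by linarith [hmin₁ q hq])
    · rw [hright] at hpu
      exact min_le_of_right_le (by linarith [hmin₂ q hq])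

end
end

section
/- Let A_1, A_2 be full-dimensional finite configurations in ℤ², A = Cay(A_1,A_2) their Cayley configuration, and e an edge of A_i (i = 1 or 2), regarded also as a face of A via the Cayley lift. Then u(e, A) = u(e, A_i). -/
open MeasureTheory

noncomputable section

/-- The trapezoid with parallel sides `{0} × [a, b]` and `{1} × [c, d]`. -/
def trapezoid (a b c d : ℝ) : Set (ℝ × ℝ) :=
  {p | p.1 ∈ Set.Icc (0 : ℝ) 1 ∧
    p.2 ∈ Set.Icc ((1 - p.1) * a + p.1 * c) ((1 - p.1) * b + p.1 * d)}

theorem convex_trapezoid (a b c d : ℝ) : Convex ℝ (trapezoid a b c d) := by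
  rintro ⟨x, y⟩ ⟨⟨h1, h2⟩, h3, h4⟩ ⟨x', y'⟩ ⟨⟨h1', h2'⟩, h3', h4'⟩ s t hs ht hst
  simp only at h1 h2 h3 h4 h1' h2' h3' h4'
  have hs' : s = 1 - t := by linarith
  refine ⟨⟨?_, ?_⟩, ?_, ?_⟩ <;> simp only [Prod.fst_add, Prod.snd_add, Prod.smul_fst,
    Prod.smul_snd, smul_eq_mul]
  · positivity
  · nlinarith
  · have := mul_le_mul_of_nonneg_left h3 hs
    have := mul_le_mul_of_nonneg_left h3' ht
    subst hs'
    linarith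
  · have := mul_le_mul_of_nonneg_left h4 hs
    have := mul_le_mul_of_nonneg_left h4' ht
    subst hs'
    linarith

theorem convexHull_eq_trapezoid {a b c d : ℝ} {X : Set (ℝ × ℝ)}
    (hX : X ⊆ trapezoid a b c d) (ha : (0, a) ∈ X) (hb : (0, b) ∈ X) (hc : (1, c) ∈ X)
    (hd : (1, d) ∈ X) : convexHull ℝ X = trapezoid a b c d := by
  refine (convexHull_min hX (convex_trapezoid a b c d)).antisymm ?_
  rintro ⟨x, y⟩ ⟨⟨h1, h2⟩, h3, h4⟩
  simp only at h1 h2 h3 h4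
  have hmem : ∀ r s : ℝ, ((0 : ℝ), r) ∈ X → ((1 : ℝ), s) ∈ X →
      (x, (1 - x) * r + x * s) ∈ convexHull ℝ X := fun r s hr hs => by
    convert (convex_convexHull ℝ X) (subset_convexHull ℝ X hr) (subset_convexHull ℝ X hs)
      (sub_nonneg.2 h2) h1 (by ring) using 1
    ext <;> simp
  have hy : y ∈ segment ℝ ((1 - x) * a + x * c) ((1 - x) * b + x * d) := by
    rw [segment_eq_Icc (h3.trans h4)]
    exact ⟨h3, h4⟩
  obtain ⟨s, t, hs, ht, hst, rfl⟩ := hy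
  convert (convex_convexHull ℝ X) (hmem a c ha hc) (hmem b d hb hd) hs ht hst using 1
  ext
  · simp [← add_mul, hst]
  · simp

theorem volume_trapezoid {a b c d : ℝ} (hab : a ≤ b) (hcd : c ≤ d) :
    volume (trapezoid a b c d) = ENNReal.ofReal (((b - a) + (d - c)) / 2) := by
  have hmeas : MeasurableSet (trapezoid a b c d) := by
    unfold trapezoid
    simp only [Set.mem_Icc]
    measurability
  rw [Measure.volume_eq_prod, Measure.prod_apply hmeas]
  have hslice : ∀ x : ℝ, volume (Prod.mk x ⁻¹' trapezoid a b c d) =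
      (Set.Icc (0 : ℝ) 1).indicator
        (fun x => ENNReal.ofReal ((1 - x) * (b - a) + x * (d - c))) x := fun x => by
    by_cases hx : x ∈ Set.Icc (0 : ℝ) 1
    · have : Prod.mk x ⁻¹' trapezoid a b c d =
          Set.Icc ((1 - x) * a + x * c) ((1 - x) * b + x * d) := by
        ext y
        exact and_iff_right hx
      rw [this, Real.volume_Icc, Set.indicator_of_mem hx]
      ring_nf
    · have : Prod.mk x ⁻¹' trapezoid a b c d = ∅ := by
        ext y
        exact iff_of_false (fun h => hx h.1) (Set.notMem_empty y)
      rw [this, measure_empty, Set.indicator_of_notMem hx]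
  simp_rw [hslice]
  rw [lintegral_indicator measurableSet_Icc, ← ofReal_integral_eq_lintegral_ofReal]
  · rw [integral_Icc_eq_integral_Ioc, ← intervalIntegral.integral_of_le zero_le_one]
    have hder : ∀ x ∈ Set.uIcc (0 : ℝ) 1, HasDerivAt
        (fun x : ℝ => x * (b - a) + x ^ 2 / 2 * ((d - c) - (b - a)))
        ((1 - x) * (b - a) + x * (d - c)) x := fun x _ => by
      refine (((hasDerivAt_id x).mul_const (b - a)).add
        ((((hasDerivAt_id x).pow 2).div_const 2).mul_const ((d - c) - (b - a)))).congr_deriv ?_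
      simp only [id, Nat.cast_ofNat]
      ring
    rw [intervalIntegral.integral_eq_sub_of_hasDerivAt hder
      (Continuous.intervalIntegrable (by fun_prop) _ _)]
    congr 1
    ring
  · exact Continuous.integrableOn_Icc (by fun_prop)
  · filter_upwards [ae_restrict_mem measurableSet_Icc] with x hx
    exact add_nonneg (mul_nonneg (sub_nonneg.2 hx.2) (sub_nonneg.2 hab))
      (mul_nonneg hx.1 (sub_nonneg.2 hcd))

/-- The linear map sending the standard basis to `h, g`. -/
def basisMap (h g : Pt) : ℝ × ℝ →ₗ[ℝ] ℝ × ℝ :=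
  Matrix.toLin (Module.Basis.finTwoProd ℝ) (Module.Basis.finTwoProd ℝ)
    !![(h.1 : ℝ), (g.1 : ℝ); (h.2 : ℝ), (g.2 : ℝ)]

theorem basisMap_intCast (h g : Pt) (x y : ℤ) :
    basisMap h g ((x : ℝ), (y : ℝ)) = toR2 (x • h + y • g) := by
  rw [basisMap, Matrix.toLin_finTwoProd_apply]
  ext <;> simp [toR2] <;> ring

/-- A configuration lying on two consecutive lattice lines parallel to `g` spans a lattice
trapezoid. -/
theorem narea_eq_of_trapezoid {g h : Pt} (hdet : |h.1 * g.2 - g.1 * h.2| = 1) {a b c d : ℤ}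
    {S : Finset Pt}
    (hS : ∀ p ∈ S, ∃ k : ℤ, (p = k • g ∧ a ≤ k ∧ k ≤ b) ∨ (p = h + k • g ∧ c ≤ k ∧ k ≤ d))
    (ha : a • g ∈ S) (hb : b • g ∈ S) (hc : h + c • g ∈ S) (hd : h + d • g ∈ S)
    (hab : a ≤ b) (hcd : c ≤ d) :
    narea S = (b - a) + (d - c) := by
  have hab' : (a : ℝ) ≤ b := by exact_mod_cast hab
  have hcd' : (c : ℝ) ≤ d := by exact_mod_cast hcd
  have hdet' : |LinearMap.det (basisMap h g)| = 1 := by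
    rw [basisMap, LinearMap.det_toLin, Matrix.det_fin_two_of]
    exact_mod_cast hdet
  have hzero : ∀ k : ℤ, basisMap h g (0, (k : ℝ)) = toR2 (k • g) := fun k => by
    simpa using basisMap_intCast h g 0 k
  have hone : ∀ k : ℤ, basisMap h g (1, (k : ℝ)) = toR2 (h + k • g) := fun k => by
    simpa using basisMap_intCast h g 1 k
  have hinj : Function.Injective (basisMap h g) := by
    have : LinearMap.det (basisMap h g) ≠ 0 := fun h0 => by simp [h0] at hdet'
    exact (LinearMap.equivOfDetNeZero _ this).injective
  set X : Set (ℝ × ℝ) := basisMap h g ⁻¹' (toR2 '' (S : Set Pt))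
  have himage : toR2 '' (S : Set Pt) = basisMap h g '' X := by
    refine (Set.image_preimage_eq_of_subset ?_).symm
    rintro _ ⟨p, hp, rfl⟩
    obtain ⟨k, ⟨rfl, -⟩ | ⟨rfl, -⟩⟩ := hS p hp
    exacts [⟨_, hzero k⟩, ⟨_, hone k⟩]
  have hX : X ⊆ trapezoid a b c d := by
    rintro x ⟨p, hp, hpx⟩
    obtain ⟨k, ⟨rfl, h1, h2⟩ | ⟨rfl, h1, h2⟩⟩ := hS p hp
    · rw [← hzero] at hpx
      rw [← hinj hpx]
      simp [trapezoid, h1, h2]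
    · rw [← hone] at hpx
      rw [← hinj hpx]
      simp [trapezoid, h1, h2]
  rw [narea, himage, ← LinearMap.image_convexHull, Measure.addHaar_image_linearMap, hdet',
    convexHull_eq_trapezoid hX ⟨_, ha, (hzero a).symm⟩ ⟨_, hb, (hzero b).symm⟩
      ⟨_, hc, (hone c).symm⟩ ⟨_, hd, (hone d).symm⟩,
    volume_trapezoid hab' hcd', ENNReal.ofReal_one, one_mul, ENNReal.toReal_ofReal (by linarith)]
  ring

theorem FullDim.nonempty_s12 {A : Finset Pt} (hA : FullDim A) : A.Nonempty := by
  rw [Finset.nonempty_iff_ne_empty]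
  rintro rfl
  exact hA (by simpa using collinear_empty ℝ (ℝ × ℝ))

/-- An additive map on `ℤ²` that identifies two distinct points of a line with primitive normal
`w` factors through `dotZ w`. -/
theorem exists_eq_dotZ_smul {w : Pt} (hw : Int.gcd w.1 w.2 = 1) (M : Pt →ₗ[ℤ] Pt) {a a' : Pt}
    (hne : a ≠ a') (hdot : dotZ w a = dotZ w a') (hM : M a = M a') :
    ∃ g : Pt, ∀ p, M p = dotZ w p • g := by
  obtain ⟨x, y, hxy⟩ : ∃ x y : ℤ, w.1 * x + w.2 * y = 1 :=
    ⟨_, _, by rw [← Int.gcd_eq_gcd_ab, hw]; rfl⟩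
  have hdecomp : ∀ p : Pt,
      p = dotZ w p • ((x, y) : Pt) + (x * p.2 - y * p.1) • ((-w.2, w.1) : Pt) := fun p => by
    ext <;> simp only [dotZ, Prod.fst_add, Prod.snd_add, Prod.smul_fst, Prod.smul_snd, smul_eq_mul]
    · linear_combination -p.1 * hxy
    · linear_combination -p.2 * hxy
  have hker : M (-w.2, w.1) = 0 := by
    rw [hdecomp a, hdecomp a', hdot] at hM
    simp only [map_add, map_smul, add_right_inj] at hM
    rw [← sub_eq_zero, ← sub_smul, smul_eq_zero] at hM
    refine hM.resolve_left fun h0 => hne ?_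
    rw [hdecomp a, hdecomp a', hdot, sub_eq_zero.1 h0]
  refine ⟨M (x, y), fun p => ?_⟩
  conv_lhs => rw [hdecomp p]
  rw [map_add, map_smul, map_smul, hker, smul_zero, add_zero]

theorem narea_sub_narea_of_edge (A B : Finset Pt) (hB : B.Nonempty) {i j : Pt} (hij : i ≠ j)
    (hspan : ∀ p : Pt, ∃ s t : ℤ, p = s • i + t • j) {w : Pt} {c : ℤ} {e : Finset Pt}
    (he : IsEdgeWith A w c e) {u : ℤ} (hu : MinOnIs (A \ e) (dotZ w) (c + u))
    {L : Pt4 →ₗ[ℤ] Pt} (hL : Function.Surjective L) (hLe : ∀ a ∈ e, L (i, a) = 0) :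
    narea ((A.image (fun a => (i, a)) ∪ B.image (fun b => (j, b))).image (fun p => L p))
      - narea (((A.image (fun a => (i, a)) ∪ B.image (fun b => (j, b))) \
          e.image (fun a => (i, a))).image (fun p => L p)) = (u : ℝ) := by
  obtain ⟨hw, hc, he_eq, hcard⟩ := he
  have hmem : ∀ a, a ∈ e ↔ a ∈ A ∧ dotZ w a = c := fun a => by rw [he_eq, Finset.mem_filter]
  obtain ⟨a, ha, a', ha', hne⟩ := Finset.one_lt_card.1 hcard
  have haA := (hmem a).1 ha
  have hsplit : ∀ q p : Pt, L (q, p) = L (q, 0) + L (0, p) := fun q p => by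
    rw [← map_add]
    simp
  obtain ⟨g, hg⟩ := exists_eq_dotZ_smul hw (L.comp (LinearMap.inr ℤ Pt Pt)) hne
    (haA.2.trans ((hmem a').1 ha').2.symm) (by
      have h1 := hLe a ha
      have h2 := hLe a' ha'
      rw [hsplit] at h1 h2
      exact add_left_cancel (h1.trans h2.symm))
  replace hg : ∀ p : Pt, L (0, p) = dotZ w p • g := hg
  set h : Pt := L (j, 0) with hh
  have hLi0 : L (i, 0) = -(c • g) := by
    have := hLe a ha
    rw [hsplit, hg, haA.2] at this
    exact eq_neg_of_add_eq_zero_left this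
  have hLi : ∀ p, L (i, p) = (dotZ w p - c) • g := fun p => by
    rw [hsplit, hLi0, hg, sub_smul]
    abel
  have hLj : ∀ p, L (j, p) = h + dotZ w p • g := fun p => by rw [hsplit, hg]
  have hgen : ∀ v : Pt, ∃ x y : ℤ, v = x • g + y • h := fun v => by
    obtain ⟨⟨q, p⟩, rfl⟩ := hL v
    obtain ⟨s, t, rfl⟩ := hspan q
    refine ⟨dotZ w p - s * c, t, ?_⟩
    have : ((s • i + t • j, p) : Pt4) = s • (i, 0) + t • (j, 0) + (0, p) := by
      ext <;> simp
    rw [this, map_add, map_add, map_smul, map_smul, hg, hLi0, ← hh, sub_smul, mul_smul]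
    simp only [smul_neg]
    abel
  have hdet : |h.1 * g.2 - g.1 * h.2| = 1 := by
    obtain ⟨x, y, hxy⟩ := hgen (1, 0)
    obtain ⟨x', y', hxy'⟩ := hgen (0, 1)
    simp only [Prod.ext_iff, Prod.fst_add, Prod.snd_add, Prod.smul_fst, Prod.smul_snd,
      smul_eq_mul] at hxy hxy'
    rw [← Int.isUnit_iff_abs_eq]
    refine IsUnit.of_mul_eq_one (y * x' - x * y') ?_
    obtain ⟨h1, h2⟩ := hxy
    obtain ⟨h3, h4⟩ := hxy'
    linear_combination (-1 : ℤ) * (x' * g.2 + y' * h.2) * h1 - h4 + h3 * (x * g.2 + y * h.2)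
  obtain ⟨⟨a₀, ha₀, ha₀u⟩, hmin⟩ := hu
  obtain ⟨a₁, ha₁, hmax⟩ := Finset.exists_max_image (A \ e) (dotZ w) ⟨a₀, ha₀⟩
  obtain ⟨b₀, hb₀, hBmin⟩ := Finset.exists_min_image B (dotZ w) hB
  obtain ⟨b₁, hb₁, hBmax⟩ := Finset.exists_max_image B (dotZ w) hB
  have hu0 := hc a₀ (Finset.mem_sdiff.1 ha₀).1
  have hu1 := hmax a₀ ha₀
  have hfull : ((A.image (fun a => (i, a)) ∪ B.image (fun b => (j, b))).image (fun p => L p)) =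
      A.image (fun a => (dotZ w a - c) • g) ∪ B.image (fun b => h + dotZ w b • g) := by
    simp only [Finset.image_union, Finset.image_image, Function.comp_def, hLi, hLj]
  have hdiff : (((A.image (fun a => (i, a)) ∪ B.image (fun b => (j, b))) \
      e.image (fun a => (i, a))).image (fun p => L p)) =
      (A \ e).image (fun a => (dotZ w a - c) • g) ∪ B.image (fun b => h + dotZ w b • g) := by
    have : (A.image (fun a => (i, a)) ∪ B.image (fun b => (j, b))) \ e.image (fun a => (i, a)) =
        (A \ e).image (fun a => (i, a)) ∪ B.image (fun b => (j, b)) := by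
      rw [Finset.union_sdiff_distrib, Finset.image_sdiff _ _ (Prod.mk_right_injective i)]
      congr 1
      refine Finset.sdiff_eq_self_of_disjoint (Finset.disjoint_left.2 fun p hp hp' => ?_)
      obtain ⟨b, -, rfl⟩ := Finset.mem_image.1 hp
      obtain ⟨b', -, hb'⟩ := Finset.mem_image.1 hp'
      exact hij (congrArg Prod.fst hb')
    simp only [this, Finset.image_union, Finset.image_image, Function.comp_def, hLi, hLj]
  have hmemB : ∀ b ∈ B, ∀ T : Finset Pt,
      h + dotZ w b • g ∈ T ∪ B.image (fun b => h + dotZ w b • g) := fun b hb T =>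
    Finset.mem_union_right _ (Finset.mem_image_of_mem _ hb)
  have hareaFull := narea_eq_of_trapezoid hdet
    (S := A.image (fun a => (dotZ w a - c) • g) ∪ B.image (fun b => h + dotZ w b • g))
    (a := 0) (b := dotZ w a₁ - c) (c := dotZ w b₀) (d := dotZ w b₁)
    (fun p hp => by
      rcases Finset.mem_union.1 hp with hp | hp
      · obtain ⟨q, hq, rfl⟩ := Finset.mem_image.1 hp
        refine ⟨_, Or.inl ⟨rfl, sub_nonneg.2 (hc q hq), sub_le_sub_right ?_ c⟩⟩
        by_cases hqe : q ∈ e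
        · have := ((hmem q).1 hqe).2
          linarith
        · exact hmax q (Finset.mem_sdiff.2 ⟨hq, hqe⟩)
      · obtain ⟨q, hq, rfl⟩ := Finset.mem_image.1 hp
        exact ⟨_, Or.inr ⟨rfl, hBmin q hq, hBmax q hq⟩⟩)
    (Finset.mem_union_left _ (Finset.mem_image.2 ⟨a, haA.1, by simp [haA.2]⟩))
    (Finset.mem_union_left _ (Finset.mem_image_of_mem _ (Finset.mem_sdiff.1 ha₁).1))
    (hmemB b₀ hb₀ _) (hmemB b₁ hb₁ _) (by linarith) (hBmin b₁ hb₁)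
  have hareaDiff := narea_eq_of_trapezoid hdet
    (S := (A \ e).image (fun a => (dotZ w a - c) • g) ∪ B.image (fun b => h + dotZ w b • g))
    (a := u) (b := dotZ w a₁ - c) (c := dotZ w b₀) (d := dotZ w b₁)
    (fun p hp => by
      rcases Finset.mem_union.1 hp with hp | hp
      · obtain ⟨q, hq, rfl⟩ := Finset.mem_image.1 hp
        exact ⟨_, Or.inl ⟨rfl, by linarith [hmin q hq], sub_le_sub_right (hmax q hq) c⟩⟩
      · obtain ⟨q, hq, rfl⟩ := Finset.mem_image.1 hp
        exact ⟨_, Or.inr ⟨rfl, hBmin q hq, hBmax q hq⟩⟩)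
    (Finset.mem_union_left _ (Finset.mem_image.2 ⟨a₀, ha₀, by simp [ha₀u]⟩))
    (Finset.mem_union_left _ (Finset.mem_image_of_mem _ ha₁))
    (hmemB b₀ hb₀ _) (hmemB b₁ hb₁ _) (by linarith) (hBmin b₁ hb₁)
  rw [hfull, hdiff, hareaFull, hareaDiff]
  push_cast
  ring

/-- **Lemma 3.6' (Lemma "prop:edges").**  Let `e` be an edge of `A_i` (for `i = 1,2`),
regarded also as a face of the Cayley configuration `A = Cay(A₁,A₂)`.  The subdiagram
volume `u(e,A)` — computed as the normalized area defect of the projection of `A` by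
any surjective integer linear map `L : ℤ⁴ → ℤ²` killing the real span of the lifted
edge — equals the subdiagram volume `u(e,A_i)` — computed as the lattice distance `u`
from the edge to the nearest point of `A_i` off its line. -/
theorem subdiagram_volume_edge_in_cayley
    (A₁ A₂ : Finset Pt) (h₁ : FullDim A₁) (h₂ : FullDim A₂) :
    (∀ (w : Pt) (c : ℤ) (e : Finset Pt), IsEdgeWith A₁ w c e →
      ∀ u : ℤ, MinOnIs (A₁ \ e) (dotZ w) (c + u) →
      ∀ L : Pt4 →ₗ[ℤ] Pt, Function.Surjective L →
        (∀ a ∈ e, L ((((1:ℤ),(0:ℤ)) : Pt), a) = 0) →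
        narea ((cayley4 A₁ A₂).image (fun p => L p))
          - narea (((cayley4 A₁ A₂) \ e.image (fun a => ((((1:ℤ),(0:ℤ)) : Pt), a))).image
              (fun p => L p)) = (u : ℝ))
    ∧ (∀ (w : Pt) (c : ℤ) (f : Finset Pt), IsEdgeWith A₂ w c f →
      ∀ u : ℤ, MinOnIs (A₂ \ f) (dotZ w) (c + u) →
      ∀ L : Pt4 →ₗ[ℤ] Pt, Function.Surjective L →
        (∀ b ∈ f, L ((((0:ℤ),(1:ℤ)) : Pt), b) = 0) →
        narea ((cayley4 A₁ A₂).image (fun p => L p))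
          - narea (((cayley4 A₁ A₂) \ f.image (fun b => ((((0:ℤ),(1:ℤ)) : Pt), b))).image
              (fun p => L p)) = (u : ℝ)) := by
  obtain ⟨x, hx⟩ := h₁.nonempty_s12
  obtain ⟨y, hy⟩ := h₂.nonempty_s12
  refine ⟨fun w c e he u hu L hL hLe => ?_, fun w c f hf u hu L hL hLf => ?_⟩
  · exact narea_sub_narea_of_edge A₁ A₂ ⟨y, hy⟩ (by simp) (fun p => ⟨p.1, p.2, by ext <;> simp⟩)
      he hu hL hLe
  · rw [cayley4, Finset.union_comm]
    exact narea_sub_narea_of_edge A₂ A₁ ⟨x, hx⟩ (by simp)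
      (fun p => ⟨p.2, p.1, by ext <;> simp⟩) hf hu hL hLf

end
end
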